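/- Let q be a prime power and n ≥ 5. Let (λ;μ) be a symbol of rank n and type B_n/C_n. Then either (λ;μ) is one of the five symbols (n; ), (0,1,n; ), (0,1; n), (1,n; 0), (0,n; 1), whose generic degrees are respectively 1, (q^n−1)(q^n−q)/(2(q+1)), (q^n+1)(q^n+q)/(2(q+1)), (q^n+1)(q^n−q)/(2(q−1)), (q^n−1)(q^n+q)/(2(q−1)), or d(λ;μ) > q^{4n−8}. Consequently, every unipotent complex character of SO_{2n+1}(q) or of PCSp_{2n}(q) is either one of the five characters labeled by these symbols (with the listed degrees) or has degree greater than q^{4n−8}. -/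

import Mathlib

/-- The exponent `N = C(a+b-2,2) + C(a+b-4,2) + ⋯` appearing in the generic degree formula. -/
def symbN (a b : ℕ) : ℕ := ∑ j ∈ Finset.range (a + b), Nat.choose (a + b - 2 * (j + 1)) 2

/-- `∏_{x < y ∈ l} (q^y - q^x)`. -/
def prodDiff (q : ℚ) (l : Finset ℕ) : ℚ :=
  ∏ x ∈ l, ∏ y ∈ l, if x < y then (q ^ y - q ^ x) else 1

/-- `∏_{x ∈ l, y ∈ m} (q^x + q^y)`. -/
def prodSum (q : ℚ) (l m : Finset ℕ) : ℚ := ∏ x ∈ l, ∏ y ∈ m, (q ^ x + q ^ y)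

/-- `∏_{x ∈ l} ∏_{k=1}^{x} (q^{2k} - 1)`. -/
def prodDen (q : ℚ) (l : Finset ℕ) : ℚ :=
  ∏ x ∈ l, ∏ k ∈ Finset.Icc 1 x, (q ^ (2 * k) - 1)

/-- `(l; m)` is a symbol of rank `n` and type `B_n/C_n`: two strictly increasing sequences of
nonnegative integers (encoded as finite sets), whose numbers `a`, `b` of entries satisfy
`a - b` odd and positive, whose first entries are not both `0`, and with
`Σ l + Σ m - ((a+b-1)/2)² = n`. -/
def IsSymbolBC (n : ℕ) (l m : Finset ℕ) : Prop :=
  m.card < l.card ∧ Odd (l.card - m.card) ∧ ¬(0 ∈ l ∧ 0 ∈ m) ∧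
    l.sum id + m.sum id = (l.card + m.card - 1) ^ 2 / 4 + n

/-- The generic degree of a symbol of type `B_n/C_n`. -/
def gdegBC (q : ℚ) (n : ℕ) (l m : Finset ℕ) : ℚ :=
  ((∏ i ∈ Finset.Icc 1 n, (q ^ (2 * i) - 1)) * prodDiff q l * prodDiff q m * prodSum q l m) /
    (2 ^ ((l.card + m.card - 1) / 2) * q ^ symbN l.card m.card * prodDen q l * prodDen q m)

lemma prodDiff_insert {q : ℚ} (hq : 1 < q) {x : ℕ} {A : Finset ℕ} (hx : x ∉ A) :
    prodDiff q (insert x A) = prodDiff q A * ∏ y ∈ A, |q ^ x - q ^ y| := by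
  unfold prodDiff
  rw [Finset.prod_insert hx, Finset.prod_insert hx]
  simp only [lt_irrefl, if_false, one_mul]
  have h : ∀ u ∈ A, (∏ y ∈ insert x A, if u < y then (q ^ y - q ^ u) else 1) =
      (if u < x then (q ^ x - q ^ u) else 1) * ∏ y ∈ A, if u < y then (q ^ y - q ^ u) else 1 :=
    fun u _ => Finset.prod_insert hx
  rw [Finset.prod_congr rfl h, Finset.prod_mul_distrib, ← mul_assoc, ← Finset.prod_mul_distrib,
    mul_comm]
  congr 1
  refine Finset.prod_congr rfl fun y hy => ?_
  rcases lt_trichotomy x y with h | h | h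
  · rw [if_pos h, if_neg h.not_gt, mul_one, abs_sub_comm, abs_of_pos]
    exact sub_pos.2 (pow_lt_pow_right₀ hq h)
  · exact absurd (h ▸ hy) hx
  · rw [if_neg h.not_gt, if_pos h, one_mul, abs_of_pos]
    exact sub_pos.2 (pow_lt_pow_right₀ hq h)

lemma prodSum_comm (q : ℚ) (A B : Finset ℕ) : prodSum q A B = prodSum q B A := by
  unfold prodSum
  rw [Finset.prod_comm]
  simp only [add_comm]

/-- `∏_{k=1}^{x} (q^{2k} - 1)`. -/
def oddOrder (q : ℚ) (x : ℕ) : ℚ := ∏ k ∈ Finset.Icc 1 x, (q ^ (2 * k) - 1)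

lemma oddOrder_zero (q : ℚ) : oddOrder q 0 = 1 := by simp [oddOrder]

lemma oddOrder_succ (q : ℚ) (x : ℕ) :
    oddOrder q (x + 1) = oddOrder q x * (q ^ (2 * (x + 1)) - 1) := by
  unfold oddOrder
  rw [Finset.prod_Icc_succ_top (by omega)]

lemma pow_sub_one_pos {q : ℚ} (hq : 1 < q) {k : ℕ} (hk : k ≠ 0) : 0 < q ^ k - 1 :=
  sub_pos.2 (one_lt_pow₀ hq hk)

lemma oddOrder_pos {q : ℚ} (hq : 1 < q) (x : ℕ) : 0 < oddOrder q x := by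
  refine Finset.prod_pos fun k hk => pow_sub_one_pos hq ?_
  have := (Finset.mem_Icc.1 hk).1
  omega

/-- The part of the generic degree that depends on the entries of the symbol. -/
def degCore (q : ℚ) (A B : Finset ℕ) : ℚ :=
  prodDiff q A * prodDiff q B * prodSum q A B / (prodDen q A * prodDen q B)

lemma degCore_comm (q : ℚ) (A B : Finset ℕ) : degCore q A B = degCore q B A := by
  unfold degCore
  rw [prodSum_comm, mul_comm (prodDiff q A), mul_comm (prodDen q A)]

lemma degCore_empty (q : ℚ) : degCore q ∅ ∅ = 1 := by
  simp [degCore, prodDiff, prodSum, prodDen]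

lemma degCore_insert {q : ℚ} (hq : 1 < q) {x : ℕ} {A : Finset ℕ} (hx : x ∉ A) (B : Finset ℕ) :
    degCore q (insert x A) B = degCore q A B *
      ((∏ y ∈ A, |q ^ x - q ^ y|) * (∏ y ∈ B, (q ^ x + q ^ y)) / oddOrder q x) := by
  have h1 : prodDen q (insert x A) = oddOrder q x * prodDen q A := Finset.prod_insert hx
  have h2 : prodSum q (insert x A) B = (∏ y ∈ B, (q ^ x + q ^ y)) * prodSum q A B :=
    Finset.prod_insert hx
  unfold degCore
  rw [prodDiff_insert hq hx, h1, h2, div_mul_div_comm]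
  congr 1 <;> ring

lemma degCore_insert_right {q : ℚ} (hq : 1 < q) {x : ℕ} {B : Finset ℕ} (hx : x ∉ B)
    (A : Finset ℕ) : degCore q A (insert x B) = degCore q A B *
      ((∏ y ∈ B, |q ^ x - q ^ y|) * (∏ y ∈ A, (q ^ x + q ^ y)) / oddOrder q x) := by
  rw [degCore_comm, degCore_insert hq hx, degCore_comm]

lemma gdegBC_eq (q : ℚ) (n : ℕ) (A B : Finset ℕ) : gdegBC q n A B =
    oddOrder q n * degCore q A B /
      (2 ^ ((A.card + B.card - 1) / 2) * q ^ symbN A.card B.card) := by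
  unfold gdegBC degCore oddOrder
  rw [mul_div_assoc', div_div]
  congr 1 <;> ring

lemma symbN_comm (a b : ℕ) : symbN a b = symbN b a := by
  unfold symbN
  rw [add_comm]

lemma gdegBC_comm (q : ℚ) (n : ℕ) (A B : Finset ℕ) : gdegBC q n A B = gdegBC q n B A := by
  rw [gdegBC_eq, gdegBC_eq, degCore_comm, symbN_comm, add_comm A.card]

lemma symbN_succ_succ (a b : ℕ) : symbN (a + 1) (b + 1) = (a + b).choose 2 + symbN a b := by
  unfold symbN
  rw [show a + 1 + (b + 1) = a + b + 1 + 1 by ring, Finset.sum_range_succ',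
    Finset.sum_range_succ, add_comm]
  have h : (a + b + 1 + 1 - 2 * (a + b + 1 + 1)).choose 2 = 0 := by
    rw [show a + b + 1 + 1 - 2 * (a + b + 1 + 1) = 0 by omega]; rfl
  rw [h, add_zero]
  congr 1
  refine Finset.sum_congr rfl fun j _ => ?_
  congr 1
  omega

/-- The ratio by which lowering the entry `x + 1` of the row `insert (x + 1) A` to `x` divides the
generic degree of a symbol of rank `n + 1` with other row `B`. -/
def hookRatio (q : ℚ) (n x : ℕ) (A B : Finset ℕ) : ℚ :=
  (q ^ (2 * (n + 1)) - 1) / (q ^ (2 * (x + 1)) - 1) *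
    (∏ y ∈ A, (q ^ (x + 1) - q ^ y) / (q ^ x - q ^ y)) *
    ∏ y ∈ B, (q ^ (x + 1) + q ^ y) / (q ^ x + q ^ y)

lemma pow_ne_pow_of_ne {q : ℚ} (hq : 1 < q) {x y : ℕ} (h : x ≠ y) : q ^ x - q ^ y ≠ 0 :=
  sub_ne_zero.2 fun h' => h (pow_right_injective₀ (by linarith) hq.ne' h')

lemma hook_term_pos {q : ℚ} (hq : 1 < q) {x y : ℕ} (h : x ≠ y) (h' : x + 1 ≠ y) :
    0 < (q ^ (x + 1) - q ^ y) / (q ^ x - q ^ y) := by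
  rcases lt_or_gt_of_ne h with h | h
  · exact div_pos_of_neg_of_neg (sub_neg.2 (pow_lt_pow_right₀ hq (by omega)))
      (sub_neg.2 (pow_lt_pow_right₀ hq h))
  · exact div_pos (sub_pos.2 (pow_lt_pow_right₀ hq (by omega)))
      (sub_pos.2 (pow_lt_pow_right₀ hq h))

lemma gdegBC_hook {q : ℚ} (hq : 1 < q) (n : ℕ) {x : ℕ} {A : Finset ℕ} (hx : x ∉ A)
    (hx' : x + 1 ∉ A) (B : Finset ℕ) :
    gdegBC q (n + 1) (insert (x + 1) A) B =
      hookRatio q n x A B * gdegBC q n (insert x A) B := by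
  have h0 : 0 < q := by linarith
  rw [gdegBC_eq, gdegBC_eq, degCore_insert hq hx, degCore_insert hq hx', oddOrder_succ,
    oddOrder_succ, Finset.card_insert_of_notMem hx, Finset.card_insert_of_notMem hx']
  have hA : ∏ y ∈ A, |q ^ (x + 1) - q ^ y| =
      (∏ y ∈ A, (q ^ (x + 1) - q ^ y) / (q ^ x - q ^ y)) * ∏ y ∈ A, |q ^ x - q ^ y| := by
    rw [← Finset.prod_mul_distrib]
    refine Finset.prod_congr rfl fun y hy => ?_
    have h1 : x ≠ y := fun h => hx (h ▸ hy)
    have h2 : x + 1 ≠ y := fun h => hx' (h ▸ hy)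
    rw [← abs_of_pos (hook_term_pos hq h1 h2), ← abs_mul,
      div_mul_cancel₀ _ (pow_ne_pow_of_ne hq h1)]
  have hB : ∏ y ∈ B, (q ^ (x + 1) + q ^ y) =
      (∏ y ∈ B, (q ^ (x + 1) + q ^ y) / (q ^ x + q ^ y)) * ∏ y ∈ B, (q ^ x + q ^ y) := by
    rw [← Finset.prod_mul_distrib]
    refine Finset.prod_congr rfl fun y _ => ?_
    have : 0 < q ^ x + q ^ y := by positivity
    field_simp
  rw [hA, hB]
  unfold hookRatio
  have h1 := (oddOrder_pos hq x).ne'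
  have h2 := (pow_sub_one_pos hq (show 2 * (x + 1) ≠ 0 by omega)).ne'
  field_simp

/-- The equivalent symbol with one more entry in each row, adding `0` and raising the others. -/
def shiftRow (A : Finset ℕ) : Finset ℕ := insert 0 (A.map (addRightEmbedding 1))

lemma prod_shiftRow (f : ℕ → ℚ) (A : Finset ℕ) :
    ∏ y ∈ shiftRow A, f y = f 0 * ∏ y ∈ A, f (y + 1) := by
  unfold shiftRow
  rw [Finset.prod_insert (by simp), Finset.prod_map]
  rfl

lemma card_shiftRow (A : Finset ℕ) : (shiftRow A).card = A.card + 1 := by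
  unfold shiftRow
  rw [Finset.card_insert_of_notMem (by simp), Finset.card_map]

lemma shiftRow_insert (x : ℕ) (A : Finset ℕ) :
    shiftRow (insert x A) = insert (x + 1) (shiftRow A) := by
  unfold shiftRow
  rw [Finset.map_insert, Finset.insert_comm]
  rfl

lemma degCore_shiftRow_insert {q : ℚ} (hq : 1 < q) {x : ℕ} {A B : Finset ℕ} (hx : x ∉ A)
    (h : degCore q (shiftRow A) (shiftRow B) =
      2 * q ^ ((A.card + B.card).choose 2) * degCore q A B) :
    degCore q (shiftRow (insert x A)) (shiftRow B) =
      2 * q ^ (((insert x A).card + B.card).choose 2) * degCore q (insert x A) B := by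
  have hx' : x + 1 ∉ shiftRow A := by simpa [shiftRow] using hx
  have h0 : 0 < q := by linarith
  rw [shiftRow_insert, degCore_insert hq hx', degCore_insert hq hx, h, prod_shiftRow,
    prod_shiftRow, oddOrder_succ, Finset.card_insert_of_notMem hx,
    show A.card + 1 + B.card = (A.card + B.card) + 1 by ring, Nat.choose_succ_succ',
    Nat.choose_one_right]
  have hA : ∏ y ∈ A, |q ^ (x + 1) - q ^ (y + 1)| = q ^ A.card * ∏ y ∈ A, |q ^ x - q ^ y| := by
    rw [← Finset.prod_const, ← Finset.prod_mul_distrib]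
    refine Finset.prod_congr rfl fun y _ => ?_
    rw [pow_succ, pow_succ, ← sub_mul, abs_mul, abs_of_pos h0, mul_comm]
  have hB : ∏ y ∈ B, (q ^ (x + 1) + q ^ (y + 1)) = q ^ B.card * ∏ y ∈ B, (q ^ x + q ^ y) := by
    rw [← Finset.prod_const, ← Finset.prod_mul_distrib]
    refine Finset.prod_congr rfl fun y _ => ?_
    ring
  have h1 := pow_sub_one_pos hq (show x + 1 ≠ 0 by omega)
  have h2 := (pow_sub_one_pos hq (show 2 * (x + 1) ≠ 0 by omega)).ne'
  have h3 := (oddOrder_pos hq x).ne'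
  rw [hA, hB, pow_zero, abs_of_pos h1]
  field_simp
  ring

lemma degCore_shift {q : ℚ} (hq : 1 < q) (A B : Finset ℕ) :
    degCore q (shiftRow A) (shiftRow B) =
      2 * q ^ ((A.card + B.card).choose 2) * degCore q A B := by
  induction A using Finset.induction_on with
  | empty =>
    induction B using Finset.induction_on with
    | empty =>
      simp [shiftRow, degCore, prodDiff, prodSum, prodDen]
      norm_num
    | insert x B hx ih =>
      rw [degCore_comm q (shiftRow ∅), degCore_comm q ∅, add_comm] at ih ⊢
      exact degCore_shiftRow_insert hq hx ih
  | insert x A hx ih => exact degCore_shiftRow_insert hq hx ih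

lemma gdegBC_shift {q : ℚ} (hq : 1 < q) (n : ℕ) {A B : Finset ℕ} (hc : 1 ≤ A.card + B.card) :
    gdegBC q n (shiftRow A) (shiftRow B) = gdegBC q n A B := by
  have h0 : 0 < q := by linarith
  rw [gdegBC_eq, gdegBC_eq, degCore_shift hq, card_shiftRow, card_shiftRow, symbN_succ_succ,
    show (A.card + 1 + (B.card + 1) - 1) / 2 = (A.card + B.card - 1) / 2 + 1 by omega]
  field_simp
  ring

/-- Symbols of rank `n` with unordered rows. -/
def IsRankSymbol (n : ℕ) (A B : Finset ℕ) : Prop :=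
  ∃ s, A.card + B.card = 2 * s + 1 ∧ ¬(0 ∈ A ∧ 0 ∈ B) ∧ A.sum id + B.sum id = s ^ 2 + n

lemma IsRankSymbol.symm {n : ℕ} {A B : Finset ℕ} (h : IsRankSymbol n A B) :
    IsRankSymbol n B A := by
  obtain ⟨s, h1, h2, h3⟩ := h
  exact ⟨s, by omega, fun h => h2 h.symm, by omega⟩

lemma IsSymbolBC.isRankSymbol {n : ℕ} {A B : Finset ℕ} (h : IsSymbolBC n A B) :
    IsRankSymbol n A B := by
  obtain ⟨h1, ⟨k, hk⟩, h2, h3⟩ := h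
  refine ⟨B.card + k, by omega, h2, ?_⟩
  rw [h3, show A.card + B.card - 1 = 2 * (B.card + k) by omega, mul_pow]
  omega

lemma card_mul_le_sum (A : Finset ℕ) : A.card * (A.card - 1) ≤ 2 * A.sum id := by
  induction A using Finset.induction_on_max with
  | empty => simp
  | insert a s ha ih =>
    have hs : a ∉ s := fun h => lt_irrefl _ (ha a h)
    have hc : s.card ≤ a := by
      simpa using Finset.card_le_card
        (fun x hx => Finset.mem_range.2 (ha x hx) : s ⊆ Finset.range a)
    rw [Finset.card_insert_of_notMem hs, Finset.sum_insert hs, id]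
    rcases Nat.eq_zero_or_pos s.card with h | h
    · simp [h]
    · obtain ⟨m, hm⟩ : ∃ m, s.card = m + 1 := ⟨s.card - 1, by omega⟩
      rw [hm] at ih hc ⊢
      simp only [Nat.add_sub_cancel] at ih ⊢
      nlinarith

lemma card_mul_le_sum_of_zero_notMem {A : Finset ℕ} (h : 0 ∉ A) :
    A.card * (A.card + 1) ≤ 2 * A.sum id := by
  have h1 := card_mul_le_sum (insert 0 A)
  rw [Finset.card_insert_of_notMem h, Finset.sum_insert h] at h1
  simp only [Nat.add_sub_cancel, id_eq, zero_add] at h1 ⊢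
  linarith

lemma sq_le_sum {A B : Finset ℕ} {s : ℕ} (hc : A.card + B.card = 2 * s)
    (h0 : ¬(0 ∈ A ∧ 0 ∈ B)) : s ^ 2 ≤ A.sum id + B.sum id := by
  wlog h : 0 ∉ B generalizing A B
  · have := this (A := B) (B := A) (by omega) (fun h => h0 h.symm)
      (fun h' => h0 ⟨h', by simpa using h⟩)
    omega
  have h1 := card_mul_le_sum A
  have h2 := card_mul_le_sum_of_zero_notMem h
  zify at *
  rcases Nat.eq_zero_or_pos A.card with h3 | h3
  · have h4 : (0 : ℤ) ≤ ∑ x ∈ A, ((id x : ℕ) : ℤ) := Finset.sum_nonneg fun _ _ => by positivity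
    have h5 : (B.card : ℤ) = 2 * s := by rw [← hc, h3]; simp
    rw [h5] at h2
    nlinarith
  · have h4 : ((A.card - 1 : ℕ) : ℤ) = A.card - 1 := by omega
    rw [h4] at h1
    have h5 : (A.card : ℤ) = 2 * s - B.card := by linarith
    rw [h5] at h1
    have : 0 ≤ ((s : ℤ) - B.card) * (s - B.card - 1) := by
      rcases le_or_gt ((s : ℤ) - B.card) 0 with h | h
      · exact mul_nonneg_of_nonpos_of_nonpos h (by linarith)
      · exact mul_nonneg h.le (by linarith [Int.add_one_le_iff.2 h])
    nlinarith

lemma IsRankSymbol.le {n : ℕ} {A B : Finset ℕ} (h : IsRankSymbol n A B) {x : ℕ} (hx : x ∈ A) :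
    x ≤ n := by
  obtain ⟨s, h1, h2, h3⟩ := h
  have h4 := sq_le_sum (A := A.erase x) (B := B) (s := s)
    (by have := Finset.card_pos.2 ⟨x, hx⟩; rw [Finset.card_erase_of_mem hx]; omega)
    (fun h => h2 ⟨Finset.mem_of_mem_erase h.1, h.2⟩)
  have h5 : id x + (A.erase x).sum id = A.sum id := Finset.add_sum_erase A id hx
  simp only [id] at h5
  simp only [id] at h3 h4
  omega

/-- Lowering an entry `x + 1` to `x` lowers the rank by one. -/
lemma IsRankSymbol.lower {n x : ℕ} {A B : Finset ℕ} (hx : x ∉ A) (hx' : x + 1 ∉ A)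
    (h0 : x = 0 → 0 ∉ B) (h : IsRankSymbol (n + 1) (insert (x + 1) A) B) :
    IsRankSymbol n (insert x A) B := by
  obtain ⟨s, h1, h2, h3⟩ := h
  rw [Finset.card_insert_of_notMem hx'] at h1
  rw [Finset.sum_insert hx'] at h3
  refine ⟨s, by rw [Finset.card_insert_of_notMem hx]; exact h1, ?_, ?_⟩
  · rintro ⟨h4, h5⟩
    rcases Finset.mem_insert.1 h4 with h6 | h6
    · exact h0 h6.symm h5
    · exact h2 ⟨Finset.mem_insert_of_mem h6, h5⟩
  · rw [Finset.sum_insert hx]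
    simp only [id] at h3 ⊢
    omega

lemma prod_telescope_ge {F : ℕ → ℚ} {x : ℕ} (hpos : ∀ y, x ≤ y → 0 < F y)
    (hF : ∀ y, x ≤ y → F (y + 1) ≤ F y) (M : ℕ) (hM : x ≤ M) (U : Finset ℕ)
    (hU : ∀ y ∈ U, x ≤ y ∧ y < M) : F M / F x ≤ ∏ y ∈ U, F (y + 1) / F y := by
  induction M, hM using Nat.le_induction generalizing U with
  | base =>
    have : U = ∅ := Finset.eq_empty_of_forall_notMem fun y hy => by have := hU y hy; omega
    rw [this, Finset.prod_empty, div_self (hpos x le_rfl).ne']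
  | succ M hM ih =>
    by_cases hMU : M ∈ U
    · rw [← Finset.mul_prod_erase U _ hMU]
      have h := ih (U.erase M) fun y hy => by
        have h1 := hU y (Finset.mem_of_mem_erase hy)
        have h2 := Finset.ne_of_mem_erase hy
        omega
      calc F (M + 1) / F x = F (M + 1) / F M * (F M / F x) := by
            have := (hpos M hM).ne'
            field_simp
        _ ≤ _ := mul_le_mul_of_nonneg_left h (div_pos (hpos _ (by omega)) (hpos _ hM)).le
    · refine le_trans ?_ (ih U fun y hy => ?_)
      · exact div_le_div_of_nonneg_right (hF M hM) (hpos x le_rfl).le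
      · have h1 := hU y hy
        have : y ≠ M := fun h => hMU (h ▸ hy)
        omega

lemma hook_term_ge {q : ℚ} (hq : 1 < q) {x y : ℕ} (h : y < x) :
    q ≤ (q ^ (x + 1) - q ^ y) / (q ^ x - q ^ y) := by
  rw [le_div_iff₀ (sub_pos.2 (pow_lt_pow_right₀ hq h)), pow_succ]
  have : 0 < q ^ y := by positivity
  nlinarith

lemma cohook_term_ge_one {q : ℚ} (hq : 1 < q) (x y : ℕ) :
    1 ≤ (q ^ (x + 1) + q ^ y) / (q ^ x + q ^ y) := by
  have h0 : 0 < q := by linarith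
  rw [le_div_iff₀ (by positivity), pow_succ]
  have : 0 < q ^ x := by positivity
  nlinarith

lemma prod_hook_above_ge {q : ℚ} (hq : 1 < q) {x : ℕ} (U : Finset ℕ)
    (hU : ∀ y ∈ U, x + 1 < y) :
    (q - 1) / q ≤ ∏ y ∈ U, (q ^ (x + 1) - q ^ y) / (q ^ x - q ^ y) := by
  have h0 : 0 < q := by linarith
  have hp : ∀ y, x + 2 ≤ y → 0 < q ^ y - q ^ (x + 1) := fun y hy =>
    sub_pos.2 (pow_lt_pow_right₀ hq (by omega))
  obtain ⟨M, hM, hUM⟩ : ∃ M, x + 2 ≤ M ∧ ∀ y ∈ U, y < M :=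
    ⟨U.sup id + x + 3, by omega, fun y hy => by
      have : y ≤ U.sup id := Finset.le_sup (f := id) hy
      omega⟩
  have h := prod_telescope_ge (F := fun y => q ^ y / (q ^ y - q ^ (x + 1))) (x := x + 2)
    (fun y hy => div_pos (by positivity) (hp y hy)) (fun y hy => by
      rw [div_le_div_iff₀ (hp _ (by omega)) (hp y hy), pow_succ q y]
      have h1 : 0 < q ^ y := by positivity
      have h2 : 0 < q ^ (x + 1) := by positivity
      have := mul_pos h1 h2
      nlinarith) M hM U fun y hy => ⟨hU y hy, hUM y hy⟩
  have h1 : ∀ y ∈ U, (q ^ (x + 1) - q ^ y) / (q ^ x - q ^ y) =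
      q ^ (y + 1) / (q ^ (y + 1) - q ^ (x + 1)) / (q ^ y / (q ^ y - q ^ (x + 1))) :=
    fun y hy => by
      have h2 := hp y (hU y hy)
      have h3 : 0 < q ^ y - q ^ x := sub_pos.2 (pow_lt_pow_right₀ hq (by have := hU y hy; omega))
      have h4 : q ^ (y + 1) - q ^ (x + 1) = q * (q ^ y - q ^ x) := by ring
      rw [h4, ← neg_sub (q ^ y), ← neg_sub (q ^ y), neg_div_neg_eq, pow_succ q y]
      field_simp
  rw [Finset.prod_congr rfl h1]
  refine le_trans ?_ h
  have h5 : q ^ (x + 2) / (q ^ (x + 2) - q ^ (x + 1)) = q / (q - 1) := by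
    have : q - 1 ≠ 0 := by linarith
    rw [show q ^ (x + 2) - q ^ (x + 1) = q ^ (x + 1) * (q - 1) by ring]
    field_simp
    ring
  rw [h5, div_div_eq_mul_div, div_le_div_iff₀ h0 h0]
  have h6 : 1 ≤ q ^ M / (q ^ M - q ^ (x + 1)) := by
    rw [le_div_iff₀ (hp M hM)]
    have : 0 < q ^ (x + 1) := by positivity
    linarith
  refine mul_le_mul_of_nonneg_right ?_ h0.le
  exact le_mul_of_one_le_left (by linarith) h6

lemma prod_hook_ge {q : ℚ} (hq : 1 < q) {x : ℕ} {A : Finset ℕ} (hx : x ∉ A) (hx' : x + 1 ∉ A) :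
    (q - 1) / q * q ^ (A.filter (· < x)).card ≤
      ∏ y ∈ A, (q ^ (x + 1) - q ^ y) / (q ^ x - q ^ y) := by
  have h0 : 0 < q := by linarith
  rw [← Finset.prod_filter_mul_prod_filter_not A (· < x), mul_comm]
  refine mul_le_mul ?_ (prod_hook_above_ge hq _ ?_) (by apply div_nonneg <;> linarith) ?_
  · rw [← Finset.prod_const]
    exact Finset.prod_le_prod (fun _ _ => h0.le) fun y hy =>
      hook_term_ge hq (Finset.mem_filter.1 hy).2
  · intro y hy
    obtain ⟨h1, h2⟩ := Finset.mem_filter.1 hy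
    have h3 : y ≠ x := fun h => hx (h ▸ h1)
    have h4 : y ≠ x + 1 := fun h => hx' (h ▸ h1)
    omega
  · exact Finset.prod_nonneg fun y hy =>
      (le_trans h0.le (hook_term_ge hq (Finset.mem_filter.1 hy).2))

lemma prod_cohook_ge {q : ℚ} (hq : 1 < q) {x m M : ℕ} (hm : m ≤ M) (U : Finset ℕ)
    (hU : ∀ y ∈ U, m ≤ y ∧ y < M) :
    (q ^ (x + 1) + q ^ m) / (q ^ (x + 1) + q ^ M) * q ^ U.card ≤
      ∏ y ∈ U, (q ^ (x + 1) + q ^ y) / (q ^ x + q ^ y) := by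
  have h0 : 0 < q := by linarith
  have h := prod_telescope_ge (F := fun y => 1 / (q ^ (x + 1) + q ^ y)) (x := m)
    (fun y _ => by positivity)
    (fun y _ => by
      have : q ^ y ≤ q ^ (y + 1) := pow_le_pow_right₀ hq.le (by omega)
      exact one_div_le_one_div_of_le (by positivity) (by linarith)) M hm U hU
  have h1 : ∀ y ∈ U, (q ^ (x + 1) + q ^ y) / (q ^ x + q ^ y) =
      (1 / (q ^ (x + 1) + q ^ (y + 1))) / (1 / (q ^ (x + 1) + q ^ y)) * q := fun y _ => by
    have : 0 < q ^ x + q ^ y := by positivity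
    have : 0 < q ^ (x + 1) + q ^ y := by positivity
    have h3 : q ^ (x + 1) + q ^ (y + 1) = q * (q ^ x + q ^ y) := by ring
    rw [h3]
    field_simp
  rw [Finset.prod_congr rfl h1, Finset.prod_mul_distrib, Finset.prod_const]
  refine mul_le_mul_of_nonneg_right (le_trans (le_of_eq ?_) h) (by positivity)
  have : 0 < q ^ (x + 1) + q ^ m := by positivity
  field_simp

lemma gdegBC_insert_top {q : ℚ} (hq : 1 < q) (n : ℕ) {x : ℕ} {A : Finset ℕ} (hx : ∀ y ∈ A, y < x)
    (B : Finset ℕ) : gdegBC q n (insert x A) B =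
      oddOrder q n / oddOrder q x *
        (degCore q A B * (∏ y ∈ A, (q ^ x - q ^ y)) * ∏ y ∈ B, (q ^ x + q ^ y)) /
        (2 ^ ((A.card + B.card) / 2) * q ^ symbN (A.card + 1) B.card) := by
  have hxA : x ∉ A := fun h => lt_irrefl _ (hx x h)
  rw [gdegBC_eq, degCore_insert hq hxA, Finset.card_insert_of_notMem hxA,
    show A.card + 1 + B.card - 1 = A.card + B.card by omega]
  have h : ∏ y ∈ A, |q ^ x - q ^ y| = ∏ y ∈ A, (q ^ x - q ^ y) :=
    Finset.prod_congr rfl fun y hy => abs_of_pos (sub_pos.2 (pow_lt_pow_right₀ hq (hx y hy)))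
  rw [h]
  congr 1
  ring

lemma degCore_pair {q : ℚ} (hq : 1 < q) : degCore q {0, 1} ∅ = 1 / (q + 1) := by
  have h1 : q - 1 ≠ 0 := by linarith
  have h2 : q + 1 ≠ 0 := by linarith
  simp [degCore, prodDiff, prodSum, prodDen]
  rw [show q ^ 2 - 1 = (q - 1) * (q + 1) by ring]
  field_simp

lemma degCore_zero_one {q : ℚ} (hq : 1 < q) : degCore q {0} {1} = 1 / (q - 1) := by
  have h1 : q - 1 ≠ 0 := by linarith
  have h2 : q + 1 ≠ 0 := by linarith
  simp [degCore, prodDiff, prodSum, prodDen]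
  rw [show q ^ 2 - 1 = (q - 1) * (q + 1) by ring]
  field_simp
  ring

lemma degCore_zero_two_empty {q : ℚ} (hq : 1 < q) : degCore q {0, 2} ∅ = 1 / (q ^ 4 - 1) := by
  have h1 : q ^ 2 - 1 ≠ 0 := by nlinarith
  have h2 : q ^ 4 - 1 ≠ 0 := (pow_sub_one_pos hq (by norm_num)).ne'
  simp [degCore, prodDiff, prodSum, prodDen, Finset.prod_Icc_succ_top]
  field_simp

lemma degCore_zero_two {q : ℚ} (hq : 1 < q) : degCore q {0} {2} = 1 / (q ^ 2 - 1) ^ 2 := by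
  have h1 : q ^ 2 - 1 ≠ 0 := by nlinarith
  have h2 : q ^ 2 + 1 ≠ 0 := by positivity
  simp [degCore, prodDiff, prodSum, prodDen, Finset.prod_Icc_succ_top]
  rw [show q ^ 4 - 1 = (q ^ 2 - 1) * (q ^ 2 + 1) by ring]
  field_simp
  ring

lemma degCore_one_one {q : ℚ} : degCore q {1} {1} = 2 * q / (q ^ 2 - 1) ^ 2 := by
  simp [degCore, prodDiff, prodSum, prodDen]
  ring

lemma degCore_three_one {q : ℚ} (hq : 1 < q) : degCore q {0, 1, 2} {1} =
    2 * q ^ 3 / (q ^ 4 - 1) := by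
  have h1 : q - 1 ≠ 0 := by linarith
  have h3 : q + 1 ≠ 0 := by linarith
  have h2 : q ^ 2 + 1 ≠ 0 := by positivity
  simp [degCore, prodDiff, prodSum, prodDen, Finset.prod_Icc_succ_top]
  rw [show q ^ 4 - 1 = (q - 1) * (q + 1) * (q ^ 2 + 1) by ring,
    show q ^ 2 - 1 = (q - 1) * (q + 1) by ring]
  field_simp
  ring

lemma degCore_two_two {q : ℚ} (hq : 1 < q) : degCore q {0, 1} {1, 2} =
    2 * q ^ 3 / (q ^ 2 - 1) ^ 2 := by
  have h1 : q - 1 ≠ 0 := by linarith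
  have h3 : q + 1 ≠ 0 := by linarith
  have h2 : q ^ 2 + 1 ≠ 0 := by positivity
  simp [degCore, prodDiff, prodSum, prodDen, Finset.prod_Icc_succ_top]
  rw [show q ^ 4 - 1 = (q - 1) * (q + 1) * (q ^ 2 + 1) by ring,
    show q ^ 2 - 1 = (q - 1) * (q + 1) by ring]
  field_simp
  ring

lemma gdegBC_insert_self {q : ℚ} (hq : 1 < q) {x : ℕ} {A : Finset ℕ} (hx : ∀ y ∈ A, y < x)
    (B : Finset ℕ) : gdegBC q x (insert x A) B =
      degCore q A B * (∏ y ∈ A, (q ^ x - q ^ y)) * (∏ y ∈ B, (q ^ x + q ^ y)) /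
        (2 ^ ((A.card + B.card) / 2) * q ^ symbN (A.card + 1) B.card) := by
  rw [gdegBC_insert_top hq x hx, div_self (oddOrder_pos hq x).ne', one_mul]

lemma gdegBC_insert_pred {q : ℚ} (hq : 1 < q) {x : ℕ} {A : Finset ℕ} (hx : ∀ y ∈ A, y < x)
    (B : Finset ℕ) : gdegBC q (x + 1) (insert x A) B =
      (q ^ 2 * (q ^ x) ^ 2 - 1) *
        (degCore q A B * (∏ y ∈ A, (q ^ x - q ^ y)) * ∏ y ∈ B, (q ^ x + q ^ y)) /
        (2 ^ ((A.card + B.card) / 2) * q ^ symbN (A.card + 1) B.card) := by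
  rw [gdegBC_insert_top hq _ hx, oddOrder_succ, mul_div_cancel_left₀ _ (oddOrder_pos hq x).ne',
    show q ^ (2 * (x + 1)) = q ^ 2 * (q ^ x) ^ 2 by ring]

lemma gdegBC_singleton {q : ℚ} (hq : 1 < q) (n : ℕ) : gdegBC q n {n} ∅ = 1 := by
  rw [← insert_empty_eq n, gdegBC_insert_self hq (by simp), degCore_empty]
  simp [symbN]

lemma gdegBC_zero_one_top {q : ℚ} (hq : 1 < q) {n : ℕ} (hn : 1 < n) :
    gdegBC q n {0, 1, n} ∅ = (q ^ n - 1) * (q ^ n - q) / (2 * (q + 1)) := by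
  have h : ({0, 1, n} : Finset ℕ) = insert n {0, 1} := by ext; simp; tauto
  rw [h, gdegBC_insert_self hq (by simp; omega), degCore_pair hq]
  simp [symbN, Finset.sum_range_succ]
  field_simp

lemma gdegBC_zero_one_right {q : ℚ} (hq : 1 < q) (n : ℕ) :
    gdegBC q n {0, 1} {n} = (q ^ n + 1) * (q ^ n + q) / (2 * (q + 1)) := by
  rw [gdegBC_comm, ← insert_empty_eq n, gdegBC_insert_self hq (by simp), degCore_comm,
    degCore_pair hq]
  simp [symbN, Finset.sum_range_succ]
  field_simp

lemma gdegBC_one_zero {q : ℚ} (hq : 1 < q) {n : ℕ} (hn : 1 < n) :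
    gdegBC q n {1, n} {0} = (q ^ n + 1) * (q ^ n - q) / (2 * (q - 1)) := by
  rw [show ({1, n} : Finset ℕ) = insert n {1} from Finset.pair_comm _ _,
    gdegBC_insert_self hq (by simpa using hn), degCore_comm, degCore_zero_one hq]
  simp [symbN, Finset.sum_range_succ]
  field_simp

lemma gdegBC_zero_one {q : ℚ} (hq : 1 < q) {n : ℕ} (hn : 0 < n) :
    gdegBC q n {0, n} {1} = (q ^ n - 1) * (q ^ n + q) / (2 * (q - 1)) := by
  rw [show ({0, n} : Finset ℕ) = insert n {0} from Finset.pair_comm _ _,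
    gdegBC_insert_self hq (by simpa using hn), degCore_zero_one hq]
  simp [symbN, Finset.sum_range_succ]
  field_simp

/-- Comparison of a quotient `P / D` with a fourth power. -/
lemma mul_pow_four_lt {q c D P z e : ℚ} (hq : 0 < q) (hD : 0 < D) (hz : 0 < z)
    (he : c * D < q ^ 8 * e) (h : e * z ^ 4 ≤ P) : c * z ^ 4 < q ^ 8 * (P / D) := by
  rw [mul_div_assoc', lt_div_iff₀ hD]
  have h0 : 0 < q ^ 8 := by positivity
  have h1 : 0 < z ^ 4 := by positivity
  nlinarith [mul_le_mul_of_nonneg_left h h0.le, mul_lt_mul_of_pos_right he h1]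

lemma four_mul_sq_le_pow {q : ℚ} (hq : 2 ≤ q) {x : ℕ} (hx : 4 ≤ x) : 4 * q ^ 2 ≤ q ^ x := by
  have := pow_le_pow_right₀ (by linarith : 1 ≤ q) hx
  have h2 := pow_le_pow_left₀ (by norm_num) hq 2
  nlinarith [sq_nonneg q]

lemma two_mul_sq_le_pow {q : ℚ} (hq : 2 ≤ q) {x : ℕ} (hx : 3 ≤ x) : 2 * q ^ 2 ≤ q ^ x := by
  have := pow_le_pow_right₀ (by linarith : 1 ≤ q) hx
  nlinarith [sq_nonneg q]

lemma bound_zero_two_top_empty {q : ℚ} (hq : 2 ≤ q) {x : ℕ} (hx : 4 ≤ x ∨ 3 ≤ q ∧ 3 ≤ x) :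
    q ^ (4 * (x + 1)) < q ^ 8 * gdegBC q (x + 1) (insert x {0, 2}) ∅ := by
  have hq1 : 1 < q := by linarith
  have hd : 0 < q ^ 4 - 1 := pow_sub_one_pos hq1 (by norm_num)
  have hq2 := pow_le_pow_left₀ (by norm_num) hq 2
  have hz : 0 < q ^ x := by positivity
  have h : gdegBC q (x + 1) (insert x {0, 2}) ∅ =
      (q ^ 2 * (q ^ x) ^ 2 - 1) * ((q ^ x - 1) * (q ^ x - q ^ 2)) / (2 * (q ^ 4 - 1)) := by
    rw [gdegBC_insert_pred hq1 (by simp; omega), degCore_zero_two_empty hq1]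
    simp [symbN, Finset.sum_range_succ]
    field_simp
  have hz1 : 4 * q ^ 2 ≤ q ^ x ∧ 16 ≤ q ^ x ∨ 3 * q ^ 2 ≤ q ^ x ∧ 27 ≤ q ^ x ∧ 9 ≤ q ^ 2 := by
    rcases hx with hx | ⟨hx1, hx⟩
    · have := four_mul_sq_le_pow hq hx
      exact Or.inl ⟨this, by linarith⟩
    · have := pow_le_pow_right₀ hq1.le hx
      have h9 := pow_le_pow_left₀ (by norm_num) hx1 2
      exact Or.inr ⟨by nlinarith, by nlinarith, by linarith⟩
  rw [h, show q ^ (4 * (x + 1)) = q ^ 4 * (q ^ x) ^ 4 by ring]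
  generalize q ^ x = z at *
  refine mul_pow_four_lt (e := 2) (by linarith) (by linarith) hz (by nlinarith) ?_
  have hzz : 0 < z ^ 2 := by positivity
  rcases hz1 with ⟨h1, h2⟩ | ⟨h1, h2, h3⟩
  · have h4 : 3 * z ^ 2 ≤ q ^ 2 * z ^ 2 - 1 := by nlinarith
    have h5 : 2 / 3 * z ^ 2 ≤ (z - 1) * (z - q ^ 2) := by nlinarith
    nlinarith [mul_le_mul h4 h5 (by positivity) (by nlinarith)]
  · have h4 : 4 * z ^ 2 ≤ q ^ 2 * z ^ 2 - 1 := by nlinarith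
    have h5 : 1 / 2 * z ^ 2 ≤ (z - 1) * (z - q ^ 2) := by nlinarith
    nlinarith [mul_le_mul h4 h5 (by positivity) (by nlinarith)]

lemma bound_top_zero_two {q : ℚ} (hq : 2 ≤ q) {x : ℕ} (hx : 2 ≤ x) :
    q ^ (4 * (x + 1)) < q ^ 8 * gdegBC q (x + 1) (insert x ∅) {0, 2} := by
  have hq1 : 1 < q := by linarith
  have hq2 := pow_le_pow_left₀ (by norm_num) hq 2
  have hq4 : 0 < q ^ 4 - 1 := pow_sub_one_pos hq1 (by norm_num)
  have hz : 0 < q ^ x := by positivity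
  have h : gdegBC q (x + 1) (insert x ∅) {0, 2} =
      (q ^ 2 * (q ^ x) ^ 2 - 1) * ((q ^ x + 1) * (q ^ x + q ^ 2)) / (2 * (q ^ 4 - 1)) := by
    rw [gdegBC_insert_pred hq1 (by simp), degCore_comm, degCore_zero_two_empty hq1]
    simp [symbN, Finset.sum_range_succ]
    field_simp
  rw [h, show q ^ (4 * (x + 1)) = q ^ 4 * (q ^ x) ^ 4 by ring]
  have hz1 : q ^ 2 ≤ q ^ x := pow_le_pow_right₀ hq1.le (by omega)

  generalize q ^ x = z at *
  have hzz : 0 < z ^ 2 := by positivity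
  refine mul_pow_four_lt (e := 2) (by linarith) (by linarith) hz (by nlinarith) ?_
  have h4 : 2 * z ^ 2 ≤ q ^ 2 * z ^ 2 - 1 := by nlinarith
  have h5 : 1 * z ^ 2 ≤ (z + 1) * (z + q ^ 2) := by nlinarith
  nlinarith [mul_le_mul h4 h5 (by nlinarith) (by nlinarith)]

lemma bound_two_top_zero {q : ℚ} (hq : 2 ≤ q) {x : ℕ} (hx : 3 ≤ x) :
    q ^ (4 * (x + 1)) < q ^ 8 * gdegBC q (x + 1) (insert x {2}) {0} := by
  have hq1 : 1 < q := by linarith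
  have hq2 := pow_le_pow_left₀ (by norm_num) hq 2
  have hq4 : 0 < q ^ 4 - 1 := pow_sub_one_pos hq1 (by norm_num)
  have hz : 0 < q ^ x := by positivity
  have h : gdegBC q (x + 1) (insert x {2}) {0} =
      (q ^ 2 * (q ^ x) ^ 2 - 1) * ((q ^ x - q ^ 2) * (q ^ x + 1)) / (2 * (q ^ 2 - 1) ^ 2) := by
    rw [gdegBC_insert_pred hq1 (by simp; omega), degCore_comm, degCore_zero_two hq1]
    simp [symbN, Finset.sum_range_succ]
    field_simp
  rw [h, show q ^ (4 * (x + 1)) = q ^ 4 * (q ^ x) ^ 4 by ring]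
  have hz1 : q ^ 2 ≤ q ^ x := pow_le_pow_right₀ hq1.le (by omega)
  have hz2 := two_mul_sq_le_pow hq hx
  generalize q ^ x = z at *
  have hzz : 0 < z ^ 2 := by positivity
  have hk : 4 * (q ^ 2 - 1) < (q ^ 2) ^ 2 := by nlinarith
  have hw : 0 < q ^ 4 * (q ^ 2 - 1) := mul_pos (by positivity) (by linarith)
  refine mul_pow_four_lt (e := (q ^ 2 - 1) / 2) (by linarith) (by nlinarith) hz
    (by nlinarith [mul_lt_mul_of_pos_left hk hw]) ?_
  have h4 : (q ^ 2 - 1) * z ^ 2 ≤ q ^ 2 * z ^ 2 - 1 := by nlinarith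
  have h5 : (1 / 2) * z ^ 2 ≤ (z - q ^ 2) * (z + 1) := by nlinarith
  nlinarith [mul_le_mul h4 h5 (by nlinarith) (by nlinarith)]

lemma bound_zero_top_two {q : ℚ} (hq : 2 ≤ q) {x : ℕ} (hx : 3 ≤ x) :
    q ^ (4 * (x + 1)) < q ^ 8 * gdegBC q (x + 1) (insert x {0}) {2} := by
  have hq1 : 1 < q := by linarith
  have hq2 := pow_le_pow_left₀ (by norm_num) hq 2
  have hq4 : 0 < q ^ 4 - 1 := pow_sub_one_pos hq1 (by norm_num)
  have hz : 0 < q ^ x := by positivity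
  have h : gdegBC q (x + 1) (insert x {0}) {2} =
      (q ^ 2 * (q ^ x) ^ 2 - 1) * ((q ^ x - 1) * (q ^ x + q ^ 2)) / (2 * (q ^ 2 - 1) ^ 2) := by
    rw [gdegBC_insert_pred hq1 (by simp; omega), degCore_zero_two hq1]
    simp [symbN, Finset.sum_range_succ]
    field_simp
  rw [h, show q ^ (4 * (x + 1)) = q ^ 4 * (q ^ x) ^ 4 by ring]
  have hz1 : q ^ 2 ≤ q ^ x := pow_le_pow_right₀ hq1.le (by omega)
  have hz2 := two_mul_sq_le_pow hq hx
  generalize q ^ x = z at *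
  have hzz : 0 < z ^ 2 := by positivity
  have hk : 4 * (q ^ 2 - 1) < (q ^ 2) ^ 2 := by nlinarith
  have hw : 0 < q ^ 4 * (q ^ 2 - 1) := mul_pos (by positivity) (by linarith)
  refine mul_pow_four_lt (e := q ^ 2 - 1) (by linarith) (by nlinarith) hz
    (by nlinarith [mul_lt_mul_of_pos_left hk hw]) ?_
  have h4 : (q ^ 2 - 1) * z ^ 2 ≤ q ^ 2 * z ^ 2 - 1 := by nlinarith
  have h5 : 1 * z ^ 2 ≤ (z - 1) * (z + q ^ 2) := by nlinarith
  nlinarith [mul_le_mul h4 h5 (by nlinarith) (by nlinarith)]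

lemma bound_one_top_one {q : ℚ} (hq : 2 ≤ q) {x : ℕ} (hx : 2 ≤ x) :
    q ^ (4 * (x + 1)) < q ^ 8 * gdegBC q (x + 1) (insert x {1}) {1} := by
  have hq1 : 1 < q := by linarith
  have hq2 := pow_le_pow_left₀ (by norm_num) hq 2
  have hq4 : 0 < q ^ 4 - 1 := pow_sub_one_pos hq1 (by norm_num)
  have hz : 0 < q ^ x := by positivity
  have h : gdegBC q (x + 1) (insert x {1}) {1} =
      (q ^ 2 * (q ^ x) ^ 2 - 1) * (2 * q * ((q ^ x - q) * (q ^ x + q))) /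
        (2 * (q ^ 2 - 1) ^ 2) := by
    rw [gdegBC_insert_pred hq1 (by simp; omega), degCore_one_one]
    simp [symbN, Finset.sum_range_succ]
    field_simp
  rw [h, show q ^ (4 * (x + 1)) = q ^ 4 * (q ^ x) ^ 4 by ring]
  have hz1 : q ^ 2 ≤ q ^ x := pow_le_pow_right₀ hq1.le (by omega)

  generalize q ^ x = z at *
  have hzz : 0 < z ^ 2 := by positivity
  have hk : 2 * (q ^ 2 - 1) < q * (q ^ 2) ^ 2 := by nlinarith
  have hw : 0 < q ^ 4 * (q ^ 2 - 1) := mul_pos (by positivity) (by linarith)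
  refine mul_pow_four_lt (e := q * (q ^ 2 - 1)) (by linarith) (by nlinarith) hz
    (by nlinarith [mul_lt_mul_of_pos_left hk hw]) ?_
  have h4 : (q ^ 2 - 1) * z ^ 2 ≤ q ^ 2 * z ^ 2 - 1 := by nlinarith
  have h5 : q * z ^ 2 ≤ 2 * q * ((z - q) * (z + q)) := by nlinarith
  nlinarith [mul_le_mul h4 h5 (by positivity) (by nlinarith)]

lemma bound_zero_one_two_top_one {q : ℚ} (hq : 2 ≤ q) {x : ℕ} (hx : 3 ≤ x) :
    q ^ (4 * x) < q ^ 8 * gdegBC q x (insert x {0, 1, 2}) {1} := by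
  have hq1 : 1 < q := by linarith
  have hq2 := pow_le_pow_left₀ (by norm_num) hq 2
  have hq4 := pow_le_pow_left₀ (by norm_num) hq 4
  have hz : 0 < q ^ x := by positivity
  have h : gdegBC q x (insert x {0, 1, 2}) {1} =
      ((q ^ x - q) * (q ^ x + q)) * ((q ^ x - 1) * (q ^ x - q ^ 2)) / (2 * (q ^ 4 - 1)) := by
    rw [gdegBC_insert_self hq1 (by simp; omega), degCore_three_one hq1]
    simp [symbN, Finset.sum_range_succ]
    field_simp
  rw [h, show q ^ (4 * x) = 1 * (q ^ x) ^ 4 by ring]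
  have hz2 := two_mul_sq_le_pow hq hx
  generalize q ^ x = z at *
  have hzz : 0 < z ^ 2 := by positivity
  refine mul_pow_four_lt (e := 1 / 8) (by linarith) (by linarith) hz (by nlinarith) ?_
  have h4 : (1 / 2) * z ^ 2 ≤ (z - q) * (z + q) := by nlinarith
  have h5 : (1 / 4) * z ^ 2 ≤ (z - 1) * (z - q ^ 2) := by nlinarith
  nlinarith [mul_le_mul h4 h5 (by nlinarith) (by nlinarith)]

lemma bound_one_top_zero_one_two {q : ℚ} (hq : 2 ≤ q) {x : ℕ} (hx : 3 ≤ x) :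
    q ^ (4 * x) < q ^ 8 * gdegBC q x (insert x {1}) {0, 1, 2} := by
  have hq1 : 1 < q := by linarith
  have hq2 := pow_le_pow_left₀ (by norm_num) hq 2
  have hq4 := pow_le_pow_left₀ (by norm_num) hq 4
  have hz : 0 < q ^ x := by positivity
  have h : gdegBC q x (insert x {1}) {0, 1, 2} =
      ((q ^ x - q) * (q ^ x + q)) * ((q ^ x + 1) * (q ^ x + q ^ 2)) / (2 * (q ^ 4 - 1)) := by
    rw [gdegBC_insert_self hq1 (by simp; omega), degCore_comm, degCore_three_one hq1]
    simp [symbN, Finset.sum_range_succ]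
    field_simp
  rw [h, show q ^ (4 * x) = 1 * (q ^ x) ^ 4 by ring]
  have hz2 := two_mul_sq_le_pow hq hx
  generalize q ^ x = z at *
  have hzz : 0 < z ^ 2 := by positivity
  refine mul_pow_four_lt (e := 1 / 2) (by linarith) (by linarith) hz (by nlinarith) ?_
  have h4 : (1 / 2) * z ^ 2 ≤ (z - q) * (z + q) := by nlinarith
  have h5 : 1 * z ^ 2 ≤ (z + 1) * (z + q ^ 2) := by nlinarith
  nlinarith [mul_le_mul h4 h5 (by nlinarith) (by nlinarith)]

lemma bound_zero_one_top_one_two {q : ℚ} (hq : 2 ≤ q) {x : ℕ} (hx : 3 ≤ x) :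
    q ^ (4 * x) < q ^ 8 * gdegBC q x (insert x {0, 1}) {1, 2} := by
  have hq1 : 1 < q := by linarith
  have hq2 := pow_le_pow_left₀ (by norm_num) hq 2
  have hq4 := pow_le_pow_left₀ (by norm_num) hq 4
  have hz : 0 < q ^ x := by positivity
  have h : gdegBC q x (insert x {0, 1}) {1, 2} =
      ((q ^ x - q) * (q ^ x + q)) * ((q ^ x - 1) * (q ^ x + q ^ 2)) / (2 * (q ^ 2 - 1) ^ 2) := by
    rw [gdegBC_insert_self hq1 (by simp; omega), degCore_two_two hq1]
    simp [symbN, Finset.sum_range_succ]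
    field_simp
  rw [h, show q ^ (4 * x) = 1 * (q ^ x) ^ 4 by ring]
  have hz2 := two_mul_sq_le_pow hq hx
  generalize q ^ x = z at *
  have hzz : 0 < z ^ 2 := by positivity
  refine mul_pow_four_lt (e := 1 / 2) (by linarith) (by nlinarith) hz (by nlinarith) ?_
  have h4 : (1 / 2) * z ^ 2 ≤ (z - q) * (z + q) := by nlinarith
  have h5 : 1 * z ^ 2 ≤ (z - 1) * (z + q ^ 2) := by nlinarith
  nlinarith [mul_le_mul h4 h5 (by nlinarith) (by nlinarith)]

lemma bound_one_two_top_zero_one {q : ℚ} (hq : 2 ≤ q) {x : ℕ} (hx : 3 ≤ x) :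
    q ^ (4 * x) < q ^ 8 * gdegBC q x (insert x {1, 2}) {0, 1} := by
  have hq1 : 1 < q := by linarith
  have hq2 := pow_le_pow_left₀ (by norm_num) hq 2
  have hq4 := pow_le_pow_left₀ (by norm_num) hq 4
  have hz : 0 < q ^ x := by positivity
  have h : gdegBC q x (insert x {1, 2}) {0, 1} =
      ((q ^ x - q) * (q ^ x + q)) * ((q ^ x + 1) * (q ^ x - q ^ 2)) / (2 * (q ^ 2 - 1) ^ 2) := by
    rw [gdegBC_insert_self hq1 (by simp; omega), degCore_comm, degCore_two_two hq1]
    simp [symbN, Finset.sum_range_succ]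
    field_simp
  rw [h, show q ^ (4 * x) = 1 * (q ^ x) ^ 4 by ring]
  have hz2 := two_mul_sq_le_pow hq hx
  generalize q ^ x = z at *
  have hzz : 0 < z ^ 2 := by positivity
  refine mul_pow_four_lt (e := 1 / 4) (by linarith) (by nlinarith) hz (by nlinarith) ?_
  have h4 : (1 / 2) * z ^ 2 ≤ (z - q) * (z + q) := by nlinarith
  have h5 : (1 / 2) * z ^ 2 ≤ (z + 1) * (z - q ^ 2) := by nlinarith
  nlinarith [mul_le_mul h4 h5 (by nlinarith) (by nlinarith)]

lemma bound_two_two {q : ℚ} (hq : 2 ≤ q) : q ^ (4 * 2) < q ^ 8 * gdegBC q 2 {0, 1, 2} {1, 2} := by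
  have hq1 : 1 < q := by linarith
  have hd : q ^ 2 - 1 ≠ 0 := (pow_sub_one_pos hq1 (by norm_num)).ne'
  have h : gdegBC q 2 {0, 1, 2} {1, 2} = q ^ 4 := by
    rw [show ({0, 1, 2} : Finset ℕ) = insert 2 {0, 1} by decide,
      gdegBC_insert_self hq1 (by simp), degCore_two_two hq1]
    simp [symbN, Finset.sum_range_succ]
    field_simp
    ring
  rw [h, show q ^ (4 * 2) = q ^ 8 by norm_num]
  have h1 := pow_le_pow_left₀ (by norm_num) hq 4
  have h2 : 0 < q ^ 8 := by positivity
  nlinarith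

lemma bound_one_two_three :
    (2 : ℚ) ^ (4 * 5) < 2 ^ 8 * gdegBC 2 5 {1, 2, 3} ∅ := by
  rw [show ({1, 2, 3} : Finset ℕ) = insert 3 {1, 2} by decide,
    gdegBC_insert_top (by norm_num) _ (by simp)]
  simp [symbN, Finset.sum_range_succ, oddOrder, Finset.prod_Icc_succ_top, degCore, prodDiff,
    prodSum, prodDen]
  norm_num

/-- The dichotomy for symbols of rank `n ≥ 2` with unordered rows: the symbol consists of a single
entry, or of the three entries `0`, `1`, `n`, or it has large generic degree, with one exception. -/
def Good (q : ℚ) (n : ℕ) (A B : Finset ℕ) : Prop :=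
  A.card + B.card = 1 ∨ (A.card + B.card = 3 ∧ (n ∈ A ∨ n ∈ B)) ∨
    (q = 2 ∧ n = 4 ∧ (A = {0, 2, 3} ∧ B = ∅ ∨ A = ∅ ∧ B = {0, 2, 3})) ∨
    q ^ (4 * n) < q ^ 8 * gdegBC q n A B

lemma Good.symm {q : ℚ} {n : ℕ} {A B : Finset ℕ} (h : Good q n A B) : Good q n B A := by
  unfold Good at *
  rw [gdegBC_comm]
  rw [add_comm A.card] at h
  tauto

lemma good_of_bound {q : ℚ} {n : ℕ} {A B : Finset ℕ} (h : q ^ (4 * n) < q ^ 8 * gdegBC q n A B) :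
    Good q n A B := Or.inr (Or.inr (Or.inr h))

lemma subset_range_of_sum_lt {A : Finset ℕ} {m : ℕ} (h : A.sum id < m) : A ⊆ Finset.range m :=
  fun _ hy => Finset.mem_range.2
    ((Finset.single_le_sum (f := id) (fun _ _ => Nat.zero_le _) hy).trans_lt h)

lemma good_three {q : ℚ} (hq : q = 2 ∨ 3 ≤ q) {x : ℕ} (hx : 2 ≤ x) {A B : Finset ℕ} (hxA : x ∈ A)
    (h : IsRankSymbol (x + 1) A B) (hc : A.card + B.card = 3) : Good q (x + 1) A B := by
  have hq2 : 2 ≤ q := by rcases hq with rfl | hq <;> linarith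
  obtain ⟨s, h1, h2, h3⟩ := h
  obtain rfl : s = 1 := by omega
  obtain ⟨A0, hxA0, rfl⟩ : ∃ A0, x ∉ A0 ∧ insert x A0 = A :=
    ⟨A.erase x, Finset.notMem_erase x A, Finset.insert_erase hxA⟩
  rw [Finset.sum_insert hxA0] at h3
  rw [Finset.card_insert_of_notMem hxA0] at hc
  simp only [id_eq] at h3
  have key : ∀ A0 ∈ (Finset.range 3).powerset, ∀ B ∈ (Finset.range 3).powerset,
      A0.card + 1 + B.card = 3 → (∑ y ∈ A0, y) + ∑ y ∈ B, y = 2 →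
        (A0 = {0, 2} ∧ B = ∅) ∨ (A0 = ∅ ∧ B = {0, 2}) ∨ (A0 = {2} ∧ B = {0}) ∨
        (A0 = {0} ∧ B = {2}) ∨ (A0 = {1} ∧ B = {1}) := by decide
  have hA : A0 ⊆ Finset.range 3 := subset_range_of_sum_lt (by simp only [id]; omega)
  have hB : B ⊆ Finset.range 3 := subset_range_of_sum_lt (by simp only [id]; omega)
  rcases key A0 (Finset.mem_powerset.2 hA) B (Finset.mem_powerset.2 hB) hc (by omega) with
    ⟨rfl, rfl⟩ | ⟨rfl, rfl⟩ | ⟨rfl, rfl⟩ | ⟨rfl, rfl⟩ | ⟨rfl, rfl⟩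
  · have hx3 : 3 ≤ x := by
      rcases Nat.lt_or_ge 2 x with h | h
      · exact h
      · exact absurd (by simp; omega) hxA0
    rcases hq with rfl | hq
    · rcases Nat.lt_or_ge 3 x with h | h
      · exact good_of_bound (bound_zero_two_top_empty hq2 (Or.inl h))
      · obtain rfl : x = 3 := by omega
        exact Or.inr (Or.inr (Or.inl ⟨rfl, rfl, Or.inl ⟨by decide, rfl⟩⟩))
    · exact good_of_bound (bound_zero_two_top_empty hq2 (Or.inr ⟨hq, hx3⟩))
  · exact good_of_bound (bound_top_zero_two hq2 hx)
  · refine good_of_bound (bound_two_top_zero hq2 ?_)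
    simp at hxA0
    omega
  · rcases Nat.lt_or_ge 2 x with h | h
    · exact good_of_bound (bound_zero_top_two hq2 h)
    · obtain rfl : x = 2 := by omega
      rw [show (insert 2 {0} : Finset ℕ) = {0, 2} by decide]
      exact (good_of_bound (bound_top_zero_two hq2 le_rfl)).symm
  · exact good_of_bound (bound_one_top_one hq2 hx)

lemma good_five {q : ℚ} (hq : 2 ≤ q) {x : ℕ} (hx : 3 ≤ x) {A B : Finset ℕ} (hxA : x ∈ A)
    (h : IsRankSymbol x A B) (hc : A.card + B.card = 5) : Good q x A B := by
  obtain ⟨s, h1, h2, h3⟩ := h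
  obtain rfl : s = 2 := by omega
  obtain ⟨A0, hxA0, rfl⟩ : ∃ A0, x ∉ A0 ∧ insert x A0 = A :=
    ⟨A.erase x, Finset.notMem_erase x A, Finset.insert_erase hxA⟩
  rw [Finset.sum_insert hxA0] at h3
  rw [Finset.card_insert_of_notMem hxA0] at hc
  simp only [id_eq] at h3
  have key : ∀ A0 ∈ (Finset.range 5).powerset, ∀ B ∈ (Finset.range 5).powerset,
      A0.card + 1 + B.card = 5 → (∑ y ∈ A0, y) + ∑ y ∈ B, y = 4 → ¬(0 ∈ A0 ∧ 0 ∈ B) →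
        (A0 = {0, 1, 2} ∧ B = {1}) ∨ (A0 = {1} ∧ B = {0, 1, 2}) ∨
        (A0 = {0, 1} ∧ B = {1, 2}) ∨ (A0 = {1, 2} ∧ B = {0, 1}) := by decide +kernel
  have hA : A0 ⊆ Finset.range 5 := subset_range_of_sum_lt (by simp only [id]; omega)
  have hB : B ⊆ Finset.range 5 := subset_range_of_sum_lt (by simp only [id]; omega)
  rcases key A0 (Finset.mem_powerset.2 hA) B (Finset.mem_powerset.2 hB) hc (by omega)
    (fun h => h2 ⟨Finset.mem_insert_of_mem h.1, h.2⟩) with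
    ⟨rfl, rfl⟩ | ⟨rfl, rfl⟩ | ⟨rfl, rfl⟩ | ⟨rfl, rfl⟩
  · exact good_of_bound (bound_zero_one_two_top_one hq hx)
  · exact good_of_bound (bound_one_top_zero_one_two hq hx)
  · exact good_of_bound (bound_zero_one_top_one_two hq hx)
  · exact good_of_bound (bound_one_two_top_zero_one hq hx)

lemma good_two {q : ℚ} (hq : 2 ≤ q) {A B : Finset ℕ} (h : IsRankSymbol 2 A B) : Good q 2 A B := by
  have hA : A ⊆ Finset.range 3 := fun x hx => Finset.mem_range.2 (Nat.lt_succ_of_le (h.le hx))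
  have hB : B ⊆ Finset.range 3 := fun x hx => Finset.mem_range.2 (Nat.lt_succ_of_le (h.symm.le hx))
  obtain ⟨s, h1, h2, h3⟩ := h
  have hs : s < 3 := by
    have h4 := Finset.card_le_card hA
    have h5 := Finset.card_le_card hB
    simp only [Finset.card_range] at h4 h5
    omega
  have key : ∀ s ∈ Finset.range 3, ∀ A ∈ (Finset.range 3).powerset, ∀ B ∈ (Finset.range 3).powerset,
      A.card + B.card = 2 * s + 1 → ¬(0 ∈ A ∧ 0 ∈ B) → A.sum id + B.sum id = s ^ 2 + 2 →
        A.card + B.card = 1 ∨ (A.card + B.card = 3 ∧ (2 ∈ A ∨ 2 ∈ B)) ∨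
        (A = {0, 1, 2} ∧ B = {1, 2}) ∨ (A = {1, 2} ∧ B = {0, 1, 2}) := by decide +kernel
  rcases key s (Finset.mem_range.2 hs) A (Finset.mem_powerset.2 hA) B (Finset.mem_powerset.2 hB)
    h1 h2 h3 with
    h | h | ⟨rfl, rfl⟩ | ⟨rfl, rfl⟩
  · exact Or.inl h
  · exact Or.inr (Or.inl h)
  · exact good_of_bound (bound_two_two hq)
  · exact (good_of_bound (bound_two_two hq)).symm

lemma bound_of_ratio {q r : ℚ} (hq : 0 < q) {n : ℕ} {A B A' B' : Finset ℕ}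
    (h : q ^ (4 * n) < q ^ 8 * gdegBC q n A' B') (hr : q ^ 4 ≤ r)
    (hd : gdegBC q (n + 1) A B = r * gdegBC q n A' B') :
    q ^ (4 * (n + 1)) < q ^ 8 * gdegBC q (n + 1) A B := by
  have h4 : 0 < q ^ 4 := by positivity
  calc q ^ (4 * (n + 1)) = q ^ 4 * q ^ (4 * n) := by ring
    _ < q ^ 4 * (q ^ 8 * gdegBC q n A' B') := mul_lt_mul_of_pos_left h h4
    _ ≤ r * (q ^ 8 * gdegBC q n A' B') :=
      mul_le_mul_of_nonneg_right hr (lt_trans (by positivity) h).le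
    _ = _ := by rw [hd]; ring

lemma good_of_hook {q : ℚ} (hq : q = 2 ∨ 3 ≤ q) {n : ℕ} (hn : 2 ≤ n)
    (ih : ∀ A B, IsRankSymbol n A B → Good q n A B) {x : ℕ} {A B : Finset ℕ} (hx : x ∉ A)
    (hx' : x + 1 ∉ A) (h0 : x = 0 → 0 ∉ B) (h : IsRankSymbol (n + 1) (insert (x + 1) A) B)
    (hr : q ^ 4 ≤ hookRatio q n x A B) : Good q (n + 1) (insert (x + 1) A) B := by
  have hq2 : 2 ≤ q := by rcases hq with rfl | hq <;> linarith
  have hc : (insert (x + 1) A).card + B.card = (insert x A).card + B.card := by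
    rw [Finset.card_insert_of_notMem hx, Finset.card_insert_of_notMem hx']
  rcases ih _ _ (h.lower hx hx' h0) with h1 | ⟨h1, h2⟩ | ⟨rfl, rfl, h1 | h1⟩ | h1
  · exact Or.inl (hc.trans h1)
  · rcases h2 with h2 | h2
    · rcases Finset.mem_insert.1 h2 with rfl | h2
      · exact Or.inr (Or.inl ⟨hc.trans h1, Or.inl (Finset.mem_insert_self _ _)⟩)
      · exact good_three hq hn (Finset.mem_insert_of_mem h2) h (hc.trans h1)
    · exact (good_three hq hn h2 h.symm (by omega)).symm
  · obtain ⟨h1, rfl⟩ := h1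
    have hA : A = ({0, 2, 3} : Finset ℕ).erase x := by rw [← h1, Finset.erase_insert hx]
    have hx3 : x ∈ ({0, 2, 3} : Finset ℕ) := h1 ▸ Finset.mem_insert_self x A
    simp only [Finset.mem_insert, Finset.mem_singleton] at hx3
    rcases hx3 with rfl | rfl | rfl
    · rw [hA]
      exact good_of_bound bound_one_two_three
    · exact absurd (by rw [hA]; decide) hx'
    · exact good_three hq (by norm_num) (Finset.mem_insert_self _ _) h
        (by rw [hA]; decide)
  · exact absurd h1.1 (Finset.insert_ne_empty _ _)
  · exact good_of_bound (bound_of_ratio (by linarith) h1 hr (gdegBC_hook (by linarith) n hx hx' B))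

lemma pow_sub_one_div_ge {q : ℚ} (hq : 1 < q) {m y : ℕ} (hy : 1 ≤ y) (hym : y ≤ m) :
    q ^ (2 * (m - y)) ≤ (q ^ (2 * m) - 1) / (q ^ (2 * y) - 1) := by
  rw [le_div_iff₀ (pow_sub_one_pos hq (by omega)), mul_sub, ← pow_add,
    show 2 * (m - y) + 2 * y = 2 * m by omega, mul_one]
  have : 1 ≤ q ^ (2 * (m - y)) := one_le_pow₀ hq.le
  linarith

lemma hookRatio_ge {q : ℚ} (hq : 1 < q) {n x : ℕ} (hx : x ≤ n) {A B : Finset ℕ} {α β : ℚ}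
    (hα : 0 ≤ α) (hβ : 0 ≤ β)
    (hA : α ≤ ∏ y ∈ A, (q ^ (x + 1) - q ^ y) / (q ^ x - q ^ y))
    (hB : β ≤ ∏ y ∈ B, (q ^ (x + 1) + q ^ y) / (q ^ x + q ^ y)) :
    q ^ (2 * (n - x)) * α * β ≤ hookRatio q n x A B := by
  have h := pow_sub_one_div_ge hq (by omega : 1 ≤ x + 1) (by omega : x + 1 ≤ n + 1)
  rw [show n + 1 - (x + 1) = n - x by omega] at h
  have h0 : 0 < q ^ (2 * (n - x)) := by positivity
  unfold hookRatio
  exact mul_le_mul (mul_le_mul h hA hα (h0.le.trans h)) hB hβ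
    (mul_nonneg (h0.le.trans h) (hα.trans hA))

lemma one_le_prod_cohook {q : ℚ} (hq : 1 < q) (x : ℕ) (B : Finset ℕ) :
    1 ≤ ∏ y ∈ B, (q ^ (x + 1) + q ^ y) / (q ^ x + q ^ y) := by
  rw [← Finset.prod_const_one (s := B)]
  exact Finset.prod_le_prod (fun _ _ => zero_le_one) fun y _ => cohook_term_ge_one hq x y

/-- The case where the largest entry can be lowered. -/
lemma good_of_lower_top {q : ℚ} (hq : q = 2 ∨ 3 ≤ q) {n : ℕ} (hn : 2 ≤ n)
    (ih : ∀ A B, IsRankSymbol n A B → Good q n A B) {x : ℕ} {A B : Finset ℕ} (hx : x ∉ A)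
    (h0 : x = 0 → 0 ∉ B) (hA : ∀ y ∈ A, y < x + 1) (hB : ∀ y ∈ B, y ≤ x + 1)
    (h : IsRankSymbol (n + 1) (insert (x + 1) A) B) : Good q (n + 1) (insert (x + 1) A) B := by
  have hq2 : 2 ≤ q := by rcases hq with rfl | hq <;> linarith
  have hq1 : 1 < q := by linarith
  have hx' : x + 1 ∉ A := fun h => lt_irrefl _ (hA _ h)
  have hxn : x + 1 ≤ n + 1 := h.le (Finset.mem_insert_self _ _)
  obtain ⟨s, h1, h2, h3⟩ := h
  by_cases hs : n - x + s ≤ 2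
  · rcases Nat.lt_or_ge s 2 with hs2 | hs2
    · interval_cases s
      · exact Or.inl h1
      · rcases Nat.lt_or_ge x n with hxn' | hxn'
        · obtain rfl : n = x + 1 := by omega
          exact good_three hq hn (Finset.mem_insert_self _ _) ⟨1, h1, h2, h3⟩ h1
        · obtain rfl : x = n := by omega
          exact Or.inr (Or.inl ⟨h1, Or.inl (Finset.mem_insert_self _ _)⟩)
    · obtain rfl : s = 2 := by omega
      obtain rfl : x = n := by omega
      exact good_five hq2 (by omega) (Finset.mem_insert_self _ _) ⟨2, h1, h2, h3⟩ h1
  · refine good_of_hook hq hn ih hx hx' h0 ⟨s, h1, h2, h3⟩ ?_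
    have hpA : q ^ A.card ≤ ∏ y ∈ A, (q ^ (x + 1) - q ^ y) / (q ^ x - q ^ y) := by
      rw [← Finset.prod_const]
      refine Finset.prod_le_prod (fun _ _ => by linarith) fun y hy => hook_term_ge hq1 ?_
      have h4 := hA y hy
      have h5 : y ≠ x := fun h => hx (h ▸ hy)
      omega
    have hpB : q ^ B.card / (q + 1) ≤ ∏ y ∈ B, (q ^ (x + 1) + q ^ y) / (q ^ x + q ^ y) := by
      refine le_trans ?_ (prod_cohook_ge hq1 (m := 0) (M := x + 2) (by omega) B
        fun y hy => ⟨by omega, by have := hB y hy; omega⟩)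
      rw [div_eq_mul_one_div, mul_comm]
      refine mul_le_mul_of_nonneg_right ?_ (by positivity)
      rw [div_le_div_iff₀ (by linarith) (by positivity), pow_succ q (x + 1)]
      nlinarith
    refine le_trans ?_ (hookRatio_ge hq1 (by omega : x ≤ n) (by positivity) (by positivity) hpA hpB)
    rw [Finset.card_insert_of_notMem hx'] at h1
    have h6 : q ^ 6 ≤ q ^ (2 * (n - x) + A.card + B.card) := pow_le_pow_right₀ hq1.le (by omega)
    rw [← pow_add, mul_div_assoc', ← pow_add, le_div_iff₀ (by linarith)]
    refine le_trans ?_ h6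
    have h7 : q ^ 4 * (q + 1) ≤ q ^ 4 * q ^ 2 :=
      mul_le_mul_of_nonneg_left (by nlinarith) (by positivity)
    linarith

/-- The case where an entry other than the largest one of its row can be lowered. -/
lemma good_of_lower_below {q : ℚ} (hq : q = 2 ∨ 3 ≤ q) {n : ℕ} (hn : 2 ≤ n)
    (ih : ∀ A B, IsRankSymbol n A B → Good q n A B) {x X : ℕ} {A B : Finset ℕ} (hx : x ∉ A)
    (hx' : x + 1 ∉ A) (h0 : x = 0 → 0 ∉ B) (hX : X ∈ A) (hxX : x + 1 < X)
    (h : IsRankSymbol (n + 1) (insert (x + 1) A) B) : Good q (n + 1) (insert (x + 1) A) B := by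
  have hq2 : 2 ≤ q := by rcases hq with rfl | hq <;> linarith
  have hq1 : 1 < q := by linarith
  have hl := h.lower hx hx' h0
  have hXn : X ≤ n := hl.le (Finset.mem_insert_of_mem hX)
  have hq4 : 0 < q ^ 4 := by positivity
  have hB1 := one_le_prod_cohook hq1 x B
  have hA1 := prod_hook_ge hq1 hx hx'
  have hq0 : 0 < (q - 1) / q := div_pos (by linarith) (by linarith)
  by_cases hbig : 3 ≤ n - x
  · refine good_of_hook hq hn ih hx hx' h0 h (le_trans ?_
      (hookRatio_ge hq1 (by omega : x ≤ n) (by positivity) zero_le_one hA1 hB1))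
    have h6 : q ^ 6 ≤ q ^ (2 * (n - x)) := pow_le_pow_right₀ hq1.le (by omega)
    have h7 : 1 ≤ q ^ (A.filter (· < x)).card := one_le_pow₀ hq1.le
    calc q ^ 4 ≤ q ^ 6 * ((q - 1) / q * 1) * 1 := by
          field_simp
          nlinarith
      _ ≤ _ := by gcongr
  obtain rfl : n = x + 2 := by omega
  obtain rfl : X = x + 2 := by omega
  rw [show x + 2 - x = 2 by omega] at *
  by_cases hyA : ∃ y ∈ A, y < x
  · obtain ⟨y, hyA, hyx⟩ := hyA
    refine good_of_hook hq hn ih hx hx' h0 h (le_trans ?_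
      (hookRatio_ge hq1 (by omega : x ≤ x + 2) (by positivity) zero_le_one hA1 hB1))
    have hc : 1 ≤ (A.filter (· < x)).card :=
      Finset.card_pos.2 ⟨y, Finset.mem_filter.2 ⟨hyA, hyx⟩⟩
    have h7 : q ^ 1 ≤ q ^ (A.filter (· < x)).card := pow_le_pow_right₀ hq1.le hc
    rw [show 2 * (x + 2 - x) = 4 by omega]
    calc q ^ 4 ≤ q ^ 4 * ((q - 1) / q * q ^ 1) * 1 := by
          field_simp
          nlinarith
      _ ≤ _ := by gcongr
  push Not at hyA
  have hA : A = {x + 2} := by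
    refine Finset.eq_singleton_iff_unique_mem.2 ⟨hX, fun y hy => ?_⟩
    have h4 := hyA y hy
    have h5 : y ≠ x := fun h => hx (h ▸ hy)
    have h6 : y ≠ x + 1 := fun h => hx' (h ▸ hy)
    have h7 := hl.le (Finset.mem_insert_of_mem hy)
    omega
  subst hA
  by_cases hyB : ∃ y ∈ B, y ≤ x
  · obtain ⟨y, hyB, hyx⟩ := hyB
    have hA2 : q / (q + 1) ≤ ∏ y ∈ ({x + 2} : Finset ℕ),
        (q ^ (x + 1) - q ^ y) / (q ^ x - q ^ y) := by
      rw [Finset.prod_singleton, ← neg_div_neg_eq (q ^ (x + 1) - _), neg_sub, neg_sub,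
        div_le_div_iff₀ (by linarith) (sub_pos.2 (pow_lt_pow_right₀ hq1 (by omega)))]
      exact le_of_eq (by ring)
    have hB2 : (q + 1) / 2 ≤ ∏ y ∈ B, (q ^ (x + 1) + q ^ y) / (q ^ x + q ^ y) := by
      rw [← Finset.mul_prod_erase B _ hyB]
      have h4 : (q + 1) / 2 ≤ (q ^ (x + 1) + q ^ y) / (q ^ x + q ^ y) := by
        rw [div_le_div_iff₀ (by norm_num) (by positivity), pow_succ]
        have : q ^ y ≤ q ^ x := pow_le_pow_right₀ hq1.le hyx
        nlinarith
      have h5 := one_le_prod_cohook hq1 x (B.erase y)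
      nlinarith
    refine good_of_hook hq hn ih hx hx' h0 h (le_trans ?_
      (hookRatio_ge hq1 (by omega : x ≤ x + 2) (by positivity) (by positivity) hA2 hB2))
    rw [show 2 * (x + 2 - x) = 4 by omega]
    have hq3 : 0 < q ^ 3 := by positivity
    field_simp
    nlinarith
  push Not at hyB
  have hB : B ⊆ {x + 1, x + 2} := fun y hy => by
    have h4 := hyB y hy
    have h5 := hl.symm.le hy
    simp
    omega
  have hc := Finset.card_le_card hB
  rw [Finset.card_pair (by omega)] at hc
  obtain ⟨s, h1, h2, h3⟩ := h
  rw [Finset.card_insert_of_notMem hx', Finset.card_singleton] at h1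
  obtain ⟨b, rfl⟩ := Finset.card_eq_one.1 (by omega : B.card = 1)
  obtain rfl : s = 1 := by simp at h1; omega
  rw [Finset.sum_insert hx'] at h3
  simp at h3 hyB
  obtain rfl : x = 0 := by omega
  obtain rfl : b = 1 := by omega
  exact good_three hq le_rfl (by decide) ⟨1, by decide, by decide, by decide⟩ (by decide)

/-- The case where the row with the largest entry is an interval and an entry of the other row can
be lowered. -/
lemma good_of_lower_other {q : ℚ} (hq : q = 2 ∨ 3 ≤ q) {n : ℕ} (hn : 2 ≤ n)
    (ih : ∀ A B, IsRankSymbol n A B → Good q n A B) {x X : ℕ} {A B : Finset ℕ} (hx : x ∉ B)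
    (hx' : x + 1 ∉ B) (hx1 : 1 ≤ x) (hxX : x + 1 ≤ X) (hA : ∀ y, 1 ≤ y → y ≤ X → y ∈ A)
    (hAX : ∀ y ∈ A, y ≤ X) (hBX : ∀ y ∈ B, y ≤ X) (h0 : 0 ∈ A ∨ 0 ∈ B)
    (h : IsRankSymbol (n + 1) (insert (x + 1) B) A) : Good q (n + 1) (insert (x + 1) B) A := by
  have hq2 : 2 ≤ q := by rcases hq with rfl | hq <;> linarith
  have hq1 : 1 < q := by linarith
  have hl := h.lower hx hx' (by omega)
  have hXn : X ≤ n := hl.symm.le (hA X (by omega) le_rfl)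
  by_cases hbig : 6 ≤ 2 * (n - x) + (x + 1)
  · have hB1 := prod_hook_ge hq1 hx hx'
    have hA1 := prod_cohook_ge hq1 (x := x) (m := 0) (M := X + 1) (by omega) A
      fun y hy => ⟨by omega, Nat.lt_succ_of_le (hAX y hy)⟩
    have hq0 : 0 < (q - 1) / q := div_pos (by linarith) (by linarith)
    refine good_of_hook hq hn ih hx hx' (by omega) h (le_trans ?_
      (hookRatio_ge hq1 (by omega : x ≤ n) (by positivity) (by positivity) hB1 hA1))
    have hsub : Finset.Icc 1 X ⊆ A := fun y hy =>
      hA y (Finset.mem_Icc.1 hy).1 (Finset.mem_Icc.1 hy).2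
    have hcard : X + 1 ≤ (B.filter (· < x)).card + A.card := by
      rcases h0 with h0 | h0
      · have h1 := Finset.card_le_card (Finset.insert_subset h0 hsub)
        rw [Finset.card_insert_of_notMem (by simp)] at h1
        simp at h1
        omega
      · have h1 := Finset.card_le_card hsub
        have h2 : 1 ≤ (B.filter (· < x)).card :=
          Finset.card_pos.2 ⟨0, Finset.mem_filter.2 ⟨h0, hx1⟩⟩
        simp at h1
        omega
    have h3 : q ^ (X + 1) ≤ q ^ ((B.filter (· < x)).card + A.card) := pow_le_pow_right₀ hq1.le hcard
    have h4 : q ^ 6 ≤ q ^ (2 * (n - x) + (x + 1)) := pow_le_pow_right₀ hq1.le hbig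
    have h5 : q ^ (x + 1) ≤ q ^ X := pow_le_pow_right₀ hq1.le hxX
    have h6 : 1 / (q ^ X * (q + 1)) ≤ 1 / (q ^ (x + 1) + q ^ (X + 1)) :=
      one_div_le_one_div_of_le (by positivity) (by rw [pow_succ q X]; linarith)
    calc q ^ 4 ≤ q ^ 6 * ((q - 1) / (q + 1)) := by
          have h7 : q ^ 4 * (q + 1) ≤ q ^ 4 * (q ^ 2 * (q - 1)) :=
            mul_le_mul_of_nonneg_left (by nlinarith) (by positivity)
          rw [mul_div_assoc', le_div_iff₀ (by linarith)]
          linarith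
      _ ≤ q ^ (2 * (n - x) + (x + 1)) * ((q - 1) / (q + 1)) :=
        mul_le_mul_of_nonneg_right h4 (div_nonneg (by linarith) (by linarith))
      _ = q ^ (2 * (n - x)) * (q - 1) / q * (q ^ (x + 1) * (1 / (q ^ X * (q + 1)))) *
          q ^ (X + 1) := by
        field_simp
        ring
      _ ≤ q ^ (2 * (n - x)) * (q - 1) / q * ((q ^ (x + 1) + q ^ 0) *
          (1 / (q ^ (x + 1) + q ^ (X + 1)))) * q ^ ((B.filter (· < x)).card + A.card) := by
        have : 0 ≤ q - 1 := by linarith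
        gcongr
        simp
      _ = _ := by
        rw [pow_add q _ A.card]
        ring
  · exfalso
    obtain rfl : n = x + 1 := by omega
    obtain rfl : X = x + 1 := by omega
    have hA' : A ⊆ Finset.range (x + 2) := fun y hy =>
      Finset.mem_range.2 (by have := hAX y hy; omega)
    have hB' : B ⊆ Finset.range x := fun y hy => by
      have h1 := hBX y hy
      have h2 : y ≠ x := fun h => hx (h ▸ hy)
      have h3 : y ≠ x + 1 := fun h => hx' (h ▸ hy)
      exact Finset.mem_range.2 (by omega)
    have h4 := Finset.card_le_card hA'
    have h5 := Finset.card_le_card hB'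
    simp only [Finset.card_range] at h4 h5
    obtain ⟨s, h1, h2, h3⟩ := h
    rw [Finset.card_insert_of_notMem hx'] at h1
    rw [Finset.sum_insert hx'] at h3
    have key : ∀ x ∈ Finset.Icc 1 2, ∀ A ∈ (Finset.range (x + 2)).powerset,
        ∀ B ∈ (Finset.range x).powerset, ∀ s ∈ Finset.range 4,
        x ∈ A ∧ x + 1 ∈ A ∧ 1 ∈ A ∧ (0 ∈ A ∨ 0 ∈ B) ∧ B.card + 1 + A.card = 2 * s + 1 →
        ¬(0 ∈ B ∧ 0 ∈ A) → x + 1 + B.sum id + A.sum id ≠ s ^ 2 + (x + 1 + 1) := by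
      decide +kernel
    exact key x (Finset.mem_Icc.2 ⟨hx1, by omega⟩) A (Finset.mem_powerset.2 hA') B
      (Finset.mem_powerset.2 hB') s (Finset.mem_range.2 (by omega))
      ⟨hA _ hx1 (by omega), hA _ (by omega) le_rfl, hA _ le_rfl (by omega), h0, h1⟩
      (fun h => h2 ⟨Finset.mem_insert_of_mem h.1, h.2⟩) h3

lemma shiftRow_Icc (b : ℕ) : shiftRow (Finset.Icc 1 b) = insert 0 (Finset.Icc 2 (b + 1)) := by
  unfold shiftRow
  rw [Finset.map_add_right_Icc]

lemma shiftRow_range (a : ℕ) : shiftRow (Finset.range a) = Finset.range (a + 1) := by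
  unfold shiftRow
  rw [Finset.range_eq_Ico, Finset.map_add_right_Ico]
  ext
  simp
  omega

lemma sum_range_id_two_mul (a : ℕ) : 2 * (Finset.range (a + 1)).sum id = a * (a + 1) := by
  have := Finset.sum_range_id_mul_two (a + 1)
  simp only [id, Nat.add_sub_cancel] at *
  linarith

lemma sum_Icc_id_two_mul (b : ℕ) : 2 * (Finset.Icc 1 b).sum id = b * (b + 1) := by
  induction b with
  | zero => simp
  | succ b ih =>
    rw [Finset.sum_Icc_succ_top (by omega), mul_add, ih]
    simp only [id]
    ring

/-- The rows `0, …, a` and `1, …, b + 1`. -/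
lemma good_range_Icc {q : ℚ} (hq : 2 ≤ q) {n : ℕ} (hn : 2 ≤ n)
    (ih : ∀ A B, IsRankSymbol n A B → Good q n A B) {a b : ℕ}
    (h : IsRankSymbol (n + 1) (Finset.range (a + 1)) (Finset.Icc 1 (b + 1))) :
    Good q (n + 1) (Finset.range (a + 1)) (Finset.Icc 1 (b + 1)) := by
  have hq1 : 1 < q := by linarith
  obtain ⟨s, h1, h2, h3⟩ := h
  have hsa := sum_range_id_two_mul a
  have hsb := sum_Icc_id_two_mul (b + 1)
  have hsb' := sum_Icc_id_two_mul b
  simp only [Finset.card_range, Nat.card_Icc] at h1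
  obtain rfl | ⟨t, rfl⟩ : s = 0 ∨ ∃ t, s = t + 1 := by
    cases s <;> simp
  · omega
  have hsr : 2 * (Finset.range a).sum id + a = a * a := by
    have := Finset.sum_range_succ id a
    simp only [id] at this hsa ⊢
    nlinarith
  have hT : IsRankSymbol n (Finset.Icc 1 b) (Finset.range a) := by
    refine ⟨t, by simp; omega, by simp, ?_⟩
    have h4 : a + b = 2 * t + 1 := by omega
    nlinarith
  have hd : gdegBC q (n + 1) (Finset.range (a + 1)) (Finset.Icc 1 (b + 1)) =
      hookRatio q n 0 (Finset.Icc 2 (b + 1)) (Finset.range (a + 1)) *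
        gdegBC q n (Finset.Icc 1 b) (Finset.range a) := by
    rw [gdegBC_comm, ← gdegBC_shift hq1 n (A := Finset.Icc 1 b) (B := Finset.range a)
      (by simp; omega), shiftRow_Icc, shiftRow_range, ← gdegBC_hook hq1 n (by simp) (by simp),
      show insert (0 + 1) (Finset.Icc 2 (b + 1)) = Finset.Icc 1 (b + 1) by ext; simp; omega]
  have hab : a + b = 2 * t + 1 := by omega
  have hr : q ^ 4 ≤ hookRatio q n 0 (Finset.Icc 2 (b + 1)) (Finset.range (a + 1)) := by
    have hA1 : (q - 1) / q ≤ ∏ y ∈ Finset.Icc 2 (b + 1), (q ^ (0 + 1) - q ^ y) / (q ^ 0 - q ^ y) :=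
      prod_hook_above_ge hq1 _ fun y hy => by simp at hy; omega
    have hq0 : 0 < (q - 1) / q := div_pos (by linarith) (by linarith)
    have hq4 : 0 < q ^ 4 := by positivity
    rcases Nat.eq_zero_or_pos a with rfl | ha
    · refine le_trans ?_ (hookRatio_ge hq1 (Nat.zero_le n) hq0.le zero_le_one hA1
        (one_le_prod_cohook hq1 _ _))
      have hn3 : 3 ≤ n := by
        obtain rfl : b = 2 * t + 1 := by omega
        rcases Nat.eq_zero_or_pos t with rfl | ht
        · simp at *
          omega
        · nlinarith
      have h6 : q ^ 6 ≤ q ^ (2 * (n - 0)) := pow_le_pow_right₀ hq1.le (by omega)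
      calc q ^ 4 ≤ q ^ 6 * ((q - 1) / q) * 1 := by
            field_simp
            nlinarith
        _ ≤ _ := by gcongr
    · have hB1 : q ≤ ∏ y ∈ Finset.range (a + 1), (q ^ (0 + 1) + q ^ y) / (q ^ 0 + q ^ y) := by
        refine le_trans ?_ (prod_cohook_ge hq1 (x := 0) (m := 0) (M := a + 1) (by omega) _
          fun y hy => ⟨by omega, Finset.mem_range.1 hy⟩)
        have h5 : q ≤ q ^ a := le_self_pow₀ hq1.le ha.ne'
        rw [div_mul_eq_mul_div, le_div_iff₀ (by positivity), Finset.card_range, pow_succ q a,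
          zero_add, pow_zero, pow_one]
        nlinarith
      refine le_trans ?_ (hookRatio_ge hq1 (Nat.zero_le n) hq0.le (by linarith) hA1 hB1)
      have h6 : q ^ 4 ≤ q ^ (2 * (n - 0)) := pow_le_pow_right₀ hq1.le (by omega)
      calc q ^ 4 ≤ q ^ 4 * ((q - 1) / q) * q := by
            field_simp
            nlinarith
        _ ≤ _ := by gcongr
  rcases ih _ _ hT with h4 | ⟨h4, h5⟩ | ⟨-, rfl, h4 | h4⟩ | h4
  · simp at h4
    exfalso
    obtain ⟨rfl, rfl⟩ | ⟨rfl, rfl⟩ : (a = 0 ∧ b = 1) ∨ (a = 1 ∧ b = 0) := by omega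
    all_goals
      obtain rfl : t = 0 := by omega
      omega
  · simp at h4 h5
    obtain rfl : t = 1 := by omega
    have hcard : (Finset.range (a + 1)).card + (Finset.Icc 1 (b + 1)).card = 5 := by
      simp
      omega
    obtain rfl : b = 3 - a := by omega
    have ha : a ≤ 3 := by omega
    interval_cases a
    · simp at hsa hsb h3 h5
      omega
    · obtain rfl : n = 2 := by simp at hsa hsb h3; omega
      exact (good_five hq le_rfl (by decide) (IsRankSymbol.symm ⟨2, hcard, h2, h3⟩)
        (by rw [add_comm]; exact hcard)).symm
    · simp at hsa hsb h3 h5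
      omega
    · obtain rfl : n = 2 := by simp at hsa hsb h3; omega
      exact good_five hq le_rfl (by decide) ⟨2, hcard, h2, h3⟩ hcard
  · have h5 : 0 ∈ Finset.Icc 1 b := h4.1 ▸ (by decide)
    simp at h5
  · have h5 : 2 ∈ Finset.range a := h4.2 ▸ (by decide)
    have h6 : 1 ∈ ({0, 2, 3} : Finset ℕ) := h4.2 ▸ (by simp at h5 ⊢; omega)
    exact absurd h6 (by decide)
  · exact good_of_bound (bound_of_ratio (by linarith) h4 hr hd)

lemma prod_Icc_ge {q : ℚ} (hq : 2 ≤ q) (m : ℕ) :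
    1 / q ^ (m + 2) ≤ ∏ y ∈ Finset.Icc 1 (m + 1), (q ^ (y + 1) - q) / (1 + q ^ (y + 1)) := by
  have hq1 : 1 < q := by linarith
  induction m with
  | zero =>
    simp only [zero_add, Finset.Icc_self, Finset.prod_singleton]
    rw [div_le_div_iff₀ (by positivity) (by positivity)]
    norm_num
    nlinarith [sq_nonneg q, sq_nonneg (q - 2)]
  | succ m ih =>
    rw [Finset.prod_Icc_succ_top (by omega)]
    have h : 1 / q ≤ (q ^ (m + 1 + 1 + 1) - q) / (1 + q ^ (m + 1 + 1 + 1)) := by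
      rw [div_le_div_iff₀ (by positivity) (by positivity)]
      have h3 : q ^ 3 ≤ q ^ (m + 1 + 1 + 1) := pow_le_pow_right₀ hq1.le (by omega)
      have h4 : q ^ 3 = q * q ^ 2 := by ring
      have h5 := mul_le_mul_of_nonneg_right h3 (by linarith : 0 ≤ q - 1)
      nlinarith [mul_nonneg (sq_nonneg q)
        (mul_nonneg (by linarith : 0 ≤ q) (by linarith : 0 ≤ q - 2)),
        mul_nonneg (sq_nonneg q) (by linarith : 0 ≤ q - 2)]
    calc 1 / q ^ (m + 1 + 2) = 1 / q ^ (m + 2) * (1 / q) := by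
          rw [div_mul_div_comm, one_mul, ← pow_succ]
      _ ≤ _ := mul_le_mul ih h (by positivity) (le_trans (by positivity) ih)

/-- Moving the entry `1` of the first row to an entry `0` of the second row. -/
lemma gdegBC_cohook {q : ℚ} (hq : 1 < q) (n : ℕ) {A : Finset ℕ} (hA : 1 ∉ A) :
    gdegBC q (n + 1) (insert 1 A) ∅ =
      (q ^ (2 * (n + 1)) - 1) / (q ^ 2 - 1) * (∏ y ∈ A, |q - q ^ y| / (1 + q ^ y)) *
        gdegBC q n A {0} := by
  have h0 : 0 < q := by linarith
  have h1 : q ^ 2 - 1 ≠ 0 := (pow_sub_one_pos hq (by norm_num)).ne'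
  have h2 : oddOrder q 1 = q ^ 2 - 1 := by simp [oddOrder]
  have h3 : ∏ y ∈ A, (1 + q ^ y) ≠ 0 := Finset.prod_ne_zero_iff.2 fun y _ => by positivity
  rw [gdegBC_eq, gdegBC_eq, degCore_insert hq hA, ← insert_empty_eq 0,
    degCore_insert_right hq (by simp), oddOrder_succ, Finset.card_insert_of_notMem hA,
    Finset.prod_div_distrib, h2, oddOrder_zero]
  simp only [Finset.prod_empty, pow_one, pow_zero, Finset.card_empty, insert_empty_eq,
    Finset.card_singleton, add_zero, mul_one, one_mul, div_one]
  rw [show symbN (A.card + 1) 0 = symbN A.card 1 from rfl]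
  field_simp

/-- The symbol with the single nonempty row `0, …, 2s`. -/
lemma good_range {q : ℚ} (hq : 2 ≤ q) {n : ℕ} (hn : 2 ≤ n)
    (ih : ∀ A B, IsRankSymbol n A B → Good q n A B) {a : ℕ}
    (h : IsRankSymbol (n + 1) (Finset.range (a + 1)) ∅) :
    Good q (n + 1) (Finset.range (a + 1)) ∅ := by
  have hq1 : 1 < q := by linarith
  obtain ⟨s, h1, h2, h3⟩ := h
  have hsa := sum_range_id_two_mul a
  simp only [Finset.card_range, Finset.card_empty, Finset.sum_empty] at h1 h3
  obtain rfl : a = 2 * s := by omega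
  have hns : n + 1 = s ^ 2 + s := by nlinarith
  obtain ⟨t, rfl⟩ : ∃ t, s = t + 2 := by
    rcases Nat.lt_or_ge s 2 with h | h
    · interval_cases s <;> omega
    · exact ⟨s - 2, by omega⟩
  have hsb := sum_Icc_id_two_mul (2 * t + 3)
  have hT : IsRankSymbol n (Finset.Icc 1 (2 * t + 3)) ∅ :=
    ⟨t + 1, by simp; omega, by simp, by simp only [Finset.sum_empty]; nlinarith⟩
  have hA : (1 : ℕ) ∉ shiftRow (Finset.Icc 1 (2 * t + 3)) := by
    rw [shiftRow_Icc]
    simp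
  have hd : gdegBC q (n + 1) (Finset.range (2 * (t + 2) + 1)) ∅ =
      (q ^ (2 * (n + 1)) - 1) / (q ^ 2 - 1) *
        ((q - 1) / 2 * ∏ y ∈ Finset.Icc 1 (2 * t + 3), (q ^ (y + 1) - q) / (1 + q ^ (y + 1))) *
        gdegBC q n (Finset.Icc 1 (2 * t + 3)) ∅ := by
    have h4 : Finset.range (2 * (t + 2) + 1) =
        insert 1 (shiftRow (Finset.Icc 1 (2 * t + 3))) := by
      rw [shiftRow_Icc]
      ext
      simp
      omega
    have h5 : shiftRow ∅ = {0} := by simp [shiftRow]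
    rw [h4, gdegBC_cohook hq1 n hA, prod_shiftRow, ← h5, gdegBC_shift hq1 n (by simp)]
    congr 3
    · rw [pow_zero, abs_of_pos (by linarith)]
      norm_num
    · refine Finset.prod_congr rfl fun y hy => ?_
      have h6 : q ≤ q ^ (y + 1) := le_self_pow₀ hq1.le (by omega)
      rw [abs_sub_comm, abs_of_nonneg (by linarith)]
  have hr : q ^ 4 ≤ (q ^ (2 * (n + 1)) - 1) / (q ^ 2 - 1) *
        ((q - 1) / 2 * ∏ y ∈ Finset.Icc 1 (2 * t + 3), (q ^ (y + 1) - q) / (1 + q ^ (y + 1))) := by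
    have h4 := pow_sub_one_div_ge hq1 le_rfl (by omega : 1 ≤ n + 1)
    have h5 := prod_Icc_ge hq (2 * t + 2)
    have h6 : 1 / q ≤ (q - 1) / 2 := by
      rw [div_le_div_iff₀ (by linarith) (by norm_num)]
      nlinarith
    have h7 : q ^ 4 * (q * q ^ (2 * t + 2 + 2)) ≤ q ^ (2 * (n + 1 - 1)) := by
      rw [← pow_succ', ← pow_add]
      exact pow_le_pow_right₀ hq1.le (by rw [Nat.add_sub_cancel]; nlinarith)
    calc q ^ 4 ≤ q ^ (2 * (n + 1 - 1)) * (1 / q * (1 / q ^ (2 * t + 2 + 2))) := by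
          rw [div_mul_div_comm, one_mul, mul_one_div, le_div_iff₀ (by positivity)]
          exact h7
      _ ≤ _ := by
        refine mul_le_mul h4 (mul_le_mul h6 h5 (by positivity) (by linarith)) (by positivity) ?_
        exact le_trans (by positivity) h4
  rcases ih _ _ hT with h4 | ⟨h4, h5⟩ | ⟨-, rfl, h4 | h4⟩ | h4
  · simp at h4
  · simp at h4 h5
    obtain rfl : t = 0 := by omega
    omega
  · have h5 : 0 ∈ Finset.Icc 1 (2 * t + 3) := h4.1 ▸ (by decide)
    simp at h5
  · exact absurd h4.2.symm (by decide)
  · exact good_of_bound (bound_of_ratio (by linarith) h4 hr hd)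

/-- A finite set of natural numbers without gaps above a positive entry is, apart from `0`, an
initial interval of the positive integers. -/
lemma exists_mem_iff_le {A : Finset ℕ} (h : ∀ x, 1 ≤ x → x + 1 ∈ A → x ∈ A) :
    ∃ b, ∀ y, 1 ≤ y → (y ∈ A ↔ y ≤ b) := by
  refine ⟨A.sup id, fun y hy => ⟨fun hyA => Finset.le_sup (f := id) hyA, fun hyb => ?_⟩⟩
  rcases A.eq_empty_or_nonempty with rfl | hA
  · simp at hyb
    omega
  · have hm : A.sup id ∈ A := by
      obtain ⟨m, hm, hm'⟩ := Finset.exists_mem_eq_sup A hA id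
      rw [hm']
      exact hm
    exact Nat.decreasingInduction' (P := fun y => 1 ≤ y → y ∈ A)
      (fun k _ _ ih hk => h k hk (ih (by omega))) hyb (fun _ => hm) hy

lemma good_of_interval {q : ℚ} (hq : 2 ≤ q) {n : ℕ} (hn : 2 ≤ n)
    (ih : ∀ A B, IsRankSymbol n A B → Good q n A B) {A B : Finset ℕ}
    (hA : ∀ x, 1 ≤ x → x + 1 ∈ A → x ∈ A) (hB : ∀ x, 1 ≤ x → x + 1 ∈ B → x ∈ B) (h0 : 0 ∈ A)
    (h : IsRankSymbol (n + 1) A B) : Good q (n + 1) A B := by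
  have h0B : 0 ∉ B := fun h0B => h.choose_spec.2.1 ⟨h0, h0B⟩
  obtain ⟨a, ha⟩ := exists_mem_iff_le hA
  obtain ⟨b, hb⟩ := exists_mem_iff_le hB
  obtain rfl : A = Finset.range (a + 1) := by
    ext y
    rcases Nat.eq_zero_or_pos y with rfl | hy
    · simpa using h0
    · simp [ha y hy]
  obtain rfl : B = Finset.Icc 1 b := by
    ext y
    rcases Nat.eq_zero_or_pos y with rfl | hy
    · simpa using h0B
    · simp [hb y hy]
      omega
  cases b with
  | zero => exact good_range hq hn ih h
  | succ b => exact good_range_Icc hq hn ih h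

lemma good_succ {q : ℚ} (hq : q = 2 ∨ 3 ≤ q) {n : ℕ} (hn : 2 ≤ n)
    (ih : ∀ A B, IsRankSymbol n A B → Good q n A B) {A B : Finset ℕ} {X : ℕ} (hX : X ∈ A)
    (hAX : ∀ y ∈ A, y ≤ X) (hBX : ∀ y ∈ B, y ≤ X)
    (h : IsRankSymbol (n + 1) A B) : Good q (n + 1) A B := by
  have hq2 : 2 ≤ q := by rcases hq with rfl | hq <;> linarith
  by_cases hlow : ∃ x, x + 1 ∈ A ∧ x ∉ A ∧ (x = 0 → 0 ∉ B)
  · obtain ⟨x, hxA, hx, h0⟩ := hlow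
    obtain ⟨A0, hx', rfl⟩ : ∃ A0, x + 1 ∉ A0 ∧ insert (x + 1) A0 = A :=
      ⟨A.erase (x + 1), Finset.notMem_erase _ A, Finset.insert_erase hxA⟩
    have hx0 : x ∉ A0 := fun h => hx (Finset.mem_insert_of_mem h)
    rcases (hAX _ hxA).eq_or_lt with rfl | hlt
    · refine good_of_lower_top hq hn ih hx0 h0 (fun y hy => ?_) hBX h
      exact lt_of_le_of_ne (hAX y (Finset.mem_insert_of_mem hy)) fun h => hx' (h ▸ hy)
    · exact good_of_lower_below hq hn ih hx0 hx' h0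
        (Finset.mem_of_mem_insert_of_ne hX hlt.ne') hlt h
  push Not at hlow
  have hA : ∀ x, 1 ≤ x → x + 1 ∈ A → x ∈ A := fun x hx hxA => by
    by_contra hx'
    exact absurd (hlow x hxA hx').1 (by omega)
  have hX0 : 1 ≤ X := by
    rcases Nat.eq_zero_or_pos X with rfl | h1
    · exfalso
      obtain ⟨s, h1, h2, h3⟩ := h
      have h4 : A.sum id = 0 := Finset.sum_eq_zero fun y hy => Nat.le_zero.1 (hAX y hy)
      have h5 : B.sum id = 0 := Finset.sum_eq_zero fun y hy => Nat.le_zero.1 (hBX y hy)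
      omega
    · exact h1
  obtain ⟨a, ha⟩ := exists_mem_iff_le hA
  have hmem : ∀ y, 1 ≤ y → y ≤ X → y ∈ A := fun y h1 h2 =>
    (ha y h1).2 (h2.trans ((ha X hX0).1 hX))
  have h0 : 0 ∈ A ∨ 0 ∈ B := by
    by_contra! h0
    exact h0.2 (hlow 0 (hmem 1 le_rfl hX0) h0.1).2
  by_cases hlowB : ∃ x, 1 ≤ x ∧ x + 1 ∈ B ∧ x ∉ B
  · obtain ⟨x, hx1, hxB, hx⟩ := hlowB
    obtain ⟨B0, hx', rfl⟩ : ∃ B0, x + 1 ∉ B0 ∧ insert (x + 1) B0 = B :=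
      ⟨B.erase (x + 1), Finset.notMem_erase _ B, Finset.insert_erase hxB⟩
    refine (good_of_lower_other hq hn ih (fun h => hx (Finset.mem_insert_of_mem h)) hx' hx1
      (hBX _ hxB) hmem hAX (fun y hy => hBX y (Finset.mem_insert_of_mem hy)) ?_ h.symm).symm
    exact h0.imp_right fun h => Finset.mem_of_mem_insert_of_ne h (by omega)
  push Not at hlowB
  rcases h0 with h0 | h0
  · exact good_of_interval hq2 hn ih hA hlowB h0 h
  · exact (good_of_interval hq2 hn ih hlowB hA h0 h.symm).symm

lemma good_of_isRankSymbol {q : ℚ} (hq : q = 2 ∨ 3 ≤ q) {n : ℕ} (hn : 2 ≤ n) :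
    ∀ A B, IsRankSymbol n A B → Good q n A B := by
  induction n, hn using Nat.le_induction with
  | base => exact fun A B h => good_two (by rcases hq with rfl | hq <;> linarith) h
  | succ n hn ih =>
    intro A B h
    have hne : (A ∪ B).Nonempty := by
      rw [Finset.nonempty_iff_ne_empty]
      intro he
      obtain ⟨rfl, rfl⟩ := Finset.union_eq_empty.1 he
      obtain ⟨s, h1, -⟩ := h
      simp at h1
    obtain ⟨X, hX, hmax⟩ := Finset.exists_max_image (A ∪ B) id hne
    have hA : ∀ y ∈ A, y ≤ X := fun y hy => hmax y (Finset.mem_union_left _ hy)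
    have hB : ∀ y ∈ B, y ≤ X := fun y hy => hmax y (Finset.mem_union_right _ hy)
    rcases Finset.mem_union.1 hX with hX | hX
    · exact good_succ hq hn ih hX hA hB h
    · exact (good_succ hq hn ih hX hB hA h.symm).symm

/-- The symbols with one entry, or with the three entries `0`, `1`, `n`. -/
lemma IsSymbolBC.eq_of_card {n : ℕ} {l m : Finset ℕ} (h : IsSymbolBC n l m)
    (hc : l.card + m.card = 1 ∨ (l.card + m.card = 3 ∧ (n ∈ l ∨ n ∈ m))) :
    (l = {n} ∧ m = ∅) ∨ (l = {0, 1, n} ∧ m = ∅) ∨ (l = {0, 1} ∧ m = {n}) ∨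
      (l = {1, n} ∧ m = {0}) ∨ (l = {0, n} ∧ m = {1}) := by
  have hlt := h.1
  obtain ⟨s, h1, h2, h3⟩ := h.isRankSymbol
  have key : ∀ A ∈ (Finset.range 2).powerset, ∀ B ∈ (Finset.range 2).powerset,
      A.card + B.card = 2 → (∑ y ∈ A, y) + ∑ y ∈ B, y = 1 →
        (A = {0, 1} ∧ B = ∅) ∨ (A = ∅ ∧ B = {0, 1}) ∨ (A = {1} ∧ B = {0}) ∨
        (A = {0} ∧ B = {1}) := by decide
  rcases hc with hc | ⟨hc, hn' | hn'⟩
  · obtain rfl : m = ∅ := Finset.card_eq_zero.1 (by omega)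
    obtain ⟨x, rfl⟩ := Finset.card_eq_one.1 (by omega : l.card = 1)
    obtain rfl : s = 0 := by omega
    simp at h3
    exact Or.inl ⟨by rw [h3], rfl⟩
  · obtain ⟨A, hnA, rfl⟩ : ∃ A, n ∉ A ∧ insert n A = l :=
      ⟨l.erase n, Finset.notMem_erase n l, Finset.insert_erase hn'⟩
    rw [Finset.card_insert_of_notMem hnA] at hc hlt h1
    obtain rfl : s = 1 := by omega
    rw [Finset.sum_insert hnA] at h3
    simp only [id_eq] at h3
    rcases key A (Finset.mem_powerset.2 (subset_range_of_sum_lt (by simp only [id]; omega))) m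
      (Finset.mem_powerset.2 (subset_range_of_sum_lt (by simp only [id]; omega))) (by omega)
      (by omega) with ⟨rfl, rfl⟩ | ⟨rfl, rfl⟩ | ⟨rfl, rfl⟩ | ⟨rfl, rfl⟩
    · refine Or.inr (Or.inl ⟨?_, rfl⟩)
      ext
      simp
      tauto
    · simp at hlt
    · exact Or.inr (Or.inr (Or.inr (Or.inl ⟨Finset.pair_comm _ _, rfl⟩)))
    · exact Or.inr (Or.inr (Or.inr (Or.inr ⟨Finset.pair_comm _ _, rfl⟩)))
  · obtain ⟨B, hnB, rfl⟩ : ∃ B, n ∉ B ∧ insert n B = m :=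
      ⟨m.erase n, Finset.notMem_erase n m, Finset.insert_erase hn'⟩
    rw [Finset.card_insert_of_notMem hnB] at hc hlt h1
    obtain rfl : s = 1 := by omega
    rw [Finset.sum_insert hnB] at h3
    simp only [id_eq] at h3
    rcases key l (Finset.mem_powerset.2 (subset_range_of_sum_lt (by simp only [id]; omega))) B
      (Finset.mem_powerset.2 (subset_range_of_sum_lt (by simp only [id]; omega))) (by omega)
      (by omega) with ⟨rfl, rfl⟩ | ⟨rfl, rfl⟩ | ⟨rfl, rfl⟩ | ⟨rfl, rfl⟩
    · exact Or.inr (Or.inr (Or.inl ⟨rfl, rfl⟩))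
    · simp at hlt
    · simp at hlt
    · simp at hlt

/-- Corollary 3.2: for `q` a prime power and `n ≥ 5`, every symbol of rank `n` and type
`B_n/C_n` is either one of the five listed symbols — with generic degrees `1`,
`(q^n-1)(q^n-q)/(2(q+1))`, `(q^n+1)(q^n+q)/(2(q+1))`, `(q^n+1)(q^n-q)/(2(q-1))`,
`(q^n-1)(q^n+q)/(2(q-1))` respectively — or has generic degree greater than `q^(4n-8)`.
Consequently (via Lusztig's classification), the same holds for the unipotent complex
characters of `SO_(2n+1)(q)` and of `PCSp_(2n)(q)`. -/
theorem symbolBC_generic_degree_gap (q n : ℕ)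
    (hq : ∃ p k : ℕ, p.Prime ∧ 0 < k ∧ q = p ^ k) (hn : 5 ≤ n) :
    gdegBC (q : ℚ) n {n} ∅ = 1 ∧
    gdegBC (q : ℚ) n {0, 1, n} ∅ =
      ((q : ℚ) ^ n - 1) * ((q : ℚ) ^ n - q) / (2 * ((q : ℚ) + 1)) ∧
    gdegBC (q : ℚ) n {0, 1} {n} =
      ((q : ℚ) ^ n + 1) * ((q : ℚ) ^ n + q) / (2 * ((q : ℚ) + 1)) ∧
    gdegBC (q : ℚ) n {1, n} {0} =
      ((q : ℚ) ^ n + 1) * ((q : ℚ) ^ n - q) / (2 * ((q : ℚ) - 1)) ∧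
    gdegBC (q : ℚ) n {0, n} {1} =
      ((q : ℚ) ^ n - 1) * ((q : ℚ) ^ n + q) / (2 * ((q : ℚ) - 1)) ∧
    ∀ l m : Finset ℕ, IsSymbolBC n l m →
      (l, m) ∉ ([(({n} : Finset ℕ), (∅ : Finset ℕ)), ({0, 1, n}, ∅), ({0, 1}, {n}), ({1, n}, {0}),
        ({0, n}, {1})] : List (Finset ℕ × Finset ℕ)) →
      (q : ℚ) ^ (4 * n - 8) < gdegBC (q : ℚ) n l m := by
  have hq2 : 2 ≤ q := by
    obtain ⟨p, k, hp, hk, rfl⟩ := hq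
    exact hp.two_le.trans (Nat.le_self_pow hk.ne' p)
  have hq1 : (1 : ℚ) < q := by exact_mod_cast hq2
  refine ⟨gdegBC_singleton hq1 n, gdegBC_zero_one_top hq1 (by omega), gdegBC_zero_one_right hq1 n,
    gdegBC_one_zero hq1 (by omega), gdegBC_zero_one hq1 (by omega), fun l m h hl => ?_⟩
  have hq3 : (q : ℚ) = 2 ∨ 3 ≤ (q : ℚ) := by
    rcases hq2.eq_or_lt with rfl | h2
    · exact Or.inl rfl
    · exact Or.inr (by exact_mod_cast h2)
  have hsmall : ¬(l.card + m.card = 1 ∨ (l.card + m.card = 3 ∧ (n ∈ l ∨ n ∈ m))) := fun hc => by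
    have h1 := h.eq_of_card hc
    simp only [List.mem_cons, Prod.mk.injEq, List.not_mem_nil, or_false] at hl
    exact hl h1
  rcases good_of_isRankSymbol hq3 (by omega) l m h.isRankSymbol with h1 | h1 | ⟨-, rfl, -⟩ | h1
  · exact absurd (Or.inl h1) hsmall
  · exact absurd (Or.inr h1) hsmall
  · omega
  · have h8 : (0 : ℚ) < (q : ℚ) ^ 8 := by positivity
    rw [show 4 * n = 8 + (4 * n - 8) by omega, pow_add] at h1
    exact lt_of_mul_lt_mul_left h1 h8.le
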